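/- arXiv:1612.07776 — 2 statements merged into one kernel-verified Lean document; each statement's English description precedes it below -/
import Mathlib

section
/- Stability of the Dyson equation: suppose d : (0,∞) → ℂ^{2n} and g = (g₁, g₂) : (0,∞) → ℍ^{2n} (each component in the complex upper half-plane) satisfy the perturbed equation g + ( iη + S_o g − τ/(iη + S_d g) )^{-1} = d (componentwise) and ⟨g₁(η)⟩ = ⟨g₂(η)⟩ for all η > 0. Then there exist constants λ_* > 0 and C > 0, depending only on s_*, s^*, τ_*, τ^*, such that for every η > 0 and every τ ∈ [0, 1−τ_*] ∪ [1+τ_*, τ^*]: if ‖g(η) − i·v^τ(η)‖_∞ ≤ λ_*, then ‖g(η) − i·v^τ(η)‖_∞ ≤ C ‖d(η)‖_∞. -/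
open Matrix

/-- The spectral radius of a real matrix (as a real number), computed via the
complex spectrum. -/
noncomputable def specRad {n : ℕ} (S : Matrix (Fin n) (Fin n) ℝ) : ℝ :=
  (spectralRadius ℂ (S.map (algebraMap ℝ ℂ))).toReal

/-- The Dyson equation together with positivity of the solution. -/
def IsDysonSolution {n : ℕ} (S : Matrix (Fin n) (Fin n) ℝ) (τ η : ℝ)
    (v₁ v₂ : Fin n → ℝ) : Prop :=
  (∀ i, 0 < v₁ i) ∧ (∀ i, 0 < v₂ i) ∧
  (∀ i, 1 / v₁ i = η + S.mulVec v₂ i + τ / (η + S.transpose.mulVec v₁ i)) ∧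
  (∀ i, 1 / v₂ i = η + S.transpose.mulVec v₁ i + τ / (η + S.mulVec v₂ i))

/-- The `2n × 2n` block matrix `S_o = [[0, S], [Sᵗ, 0]]`. -/
def SoM {n : ℕ} (S : Matrix (Fin n) (Fin n) ℝ) :
    Matrix (Fin n ⊕ Fin n) (Fin n ⊕ Fin n) ℝ :=
  Matrix.fromBlocks 0 S S.transpose 0

/-- The `2n × 2n` block matrix `S_d = [[Sᵗ, 0], [0, S]]`. -/
def SdM {n : ℕ} (S : Matrix (Fin n) (Fin n) ℝ) :
    Matrix (Fin n ⊕ Fin n) (Fin n ⊕ Fin n) ℝ :=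
  Matrix.fromBlocks S.transpose 0 0 S

/-- The perturbed Dyson equation
`g + (iη + S_o g − τ/(iη + S_d g))⁻¹ = d` (componentwise). -/
def PerturbedDysonEq {n : ℕ} (S : Matrix (Fin n) (Fin n) ℝ) (τ : ℝ)
    (g d : ℝ → (Fin n ⊕ Fin n → ℂ)) : Prop :=
  ∀ η : ℝ, 0 < η → ∀ k,
    g η k + (Complex.I * η + ((SoM S).map (Complex.ofReal)).mulVec (g η) k
      - τ / (Complex.I * η + ((SdM S).map (Complex.ofReal)).mulVec (g η) k))⁻¹ =
      d η k

/-- If the spectral radius of a nonnegative matrix is `1`, then no positive vector is mapped by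
the transpose to a componentwise strictly smaller vector. -/
theorem exists_le_transpose_mulVec {n : ℕ} {S : Matrix (Fin n) (Fin n) ℝ} (hn : 1 ≤ n)
    (hS : ∀ i j, 0 ≤ S i j) (hr : specRad S = 1) {v : Fin n → ℝ} (hv : ∀ i, 0 < v i) :
    ∃ i, v i ≤ (Sᵀ *ᵥ v) i := by
  have : NeZero n := ⟨by omega⟩
  let : NormedRing (Matrix (Fin n) (Fin n) ℂ) := Matrix.linftyOpNormedRing
  let : NormedAlgebra ℂ (Matrix (Fin n) (Fin n) ℂ) := Matrix.linftyOpNormedAlgebra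
  have : CompleteSpace (Matrix (Fin n) (Fin n) ℂ) := FiniteDimensional.complete ℂ _
  by_contra! hlt
  obtain ⟨μ, hμ, hμr⟩ :=
    spectrum.exists_nnnorm_eq_spectralRadius (S.map (algebraMap ℝ ℂ))
  have hμ1 : ‖μ‖ = 1 := by
    rw [specRad, ← hμr] at hr
    simpa using hr
  rw [spectrum.mem_iff, Matrix.isUnit_iff_isUnit_det, isUnit_iff_ne_zero, not_not] at hμ
  obtain ⟨x, hx0, hx⟩ := Matrix.exists_vecMul_eq_zero_iff.mpr hμ
  have hx' : ∀ j, μ * x j = ∑ i, (S i j : ℂ) * x i := by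
    intro j
    have := congrFun hx j
    rw [Matrix.vecMul_sub, Pi.sub_apply, Pi.zero_apply, sub_eq_zero,
      Algebra.algebraMap_eq_smul_one, Matrix.vecMul_smul, Matrix.vecMul_one] at this
    simp only [Pi.smul_apply, smul_eq_mul] at this
    rw [this]
    simp [Matrix.vecMul, dotProduct, mul_comm]
  obtain ⟨k, hk⟩ := Finite.exists_max (fun i => ‖x i‖ / v i)
  obtain ⟨l, hl⟩ := Function.ne_iff.mp hx0
  have hpos : 0 < ‖x k‖ / v k :=
    lt_of_lt_of_le (div_pos (norm_pos_iff.mpr hl) (hv l)) (hk l)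
  have hle : ‖x k‖ ≤ (‖x k‖ / v k) * (Sᵀ *ᵥ v) k := by
    calc ‖x k‖ = ‖μ * x k‖ := by rw [norm_mul, hμ1, one_mul]
      _ ≤ ∑ i, ‖(S i k : ℂ) * x i‖ := by rw [hx']; exact norm_sum_le _ _
      _ ≤ ∑ i, (‖x k‖ / v k) * (S i k * v i) := by
          refine Finset.sum_le_sum fun i _ => ?_
          rw [norm_mul, Complex.norm_real, Real.norm_of_nonneg (hS i k)]
          have h1 : ‖x i‖ ≤ (‖x k‖ / v k) * v i := (div_le_iff₀ (hv i)).mp (hk i)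
          nlinarith [mul_le_mul_of_nonneg_left h1 (hS i k)]
      _ = _ := by
          simp [Matrix.mulVec, dotProduct, Finset.mul_sum]
  have hlt' := mul_lt_mul_of_pos_left (hlt k) hpos
  rw [div_mul_cancel₀ _ (hv k).ne'] at hlt'
  linarith

/-- If the spectral radius of a nonnegative matrix is `1`, then its transpose does not expand
a positive vector by a factor larger than `1`. -/
theorem le_one_of_smul_le_transpose_mulVec {n : ℕ} {S : Matrix (Fin n) (Fin n) ℝ} (hn : 1 ≤ n)
    (hS : ∀ i j, 0 ≤ S i j) (hr : specRad S = 1) {v : Fin n → ℝ} (hv : ∀ i, 0 < v i)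
    {t : ℝ} (ht : ∀ i, t * v i ≤ (Sᵀ *ᵥ v) i) : t ≤ 1 := by
  have : NeZero n := ⟨by omega⟩
  let : NormedRing (Matrix (Fin n) (Fin n) ℂ) := Matrix.linftyOpNormedRing
  let : NormedAlgebra ℂ (Matrix (Fin n) (Fin n) ℂ) := Matrix.linftyOpNormedAlgebra
  have : CompleteSpace (Matrix (Fin n) (Fin n) ℂ) := FiniteDimensional.complete ℂ _
  by_contra! h1
  have ht0 : 0 ≤ t := by linarith
  set M := S.map (algebraMap ℝ ℂ) with hM
  have hrad : spectralRadius ℂ M = 1 := by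
    rw [specRad] at hr
    exact (ENNReal.toReal_eq_one_iff _).mp hr
  have hpow : ∀ k : ℕ, ∀ j, t ^ k * v j ≤ (v ᵥ* S ^ k) j := by
    intro k
    induction k with
    | zero => simp
    | succ k ih =>
      intro j
      rw [pow_succ S, ← Matrix.vecMul_vecMul]
      calc t ^ (k + 1) * v j = t ^ k * (t * v j) := by ring
        _ ≤ t ^ k * (Sᵀ *ᵥ v) j := mul_le_mul_of_nonneg_left (ht j) (by positivity)
        _ = ∑ i, (t ^ k * v i) * S i j := by
            simp only [Matrix.mulVec, dotProduct, Matrix.transpose_apply, Finset.mul_sum]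
            exact Finset.sum_congr rfl fun i _ => by ring
        _ ≤ ∑ i, (v ᵥ* S ^ k) i * S i j :=
            Finset.sum_le_sum fun i _ => mul_le_mul_of_nonneg_right (ih i) (hS i j)
        _ = _ := rfl
  have hnorm : ∀ k : ℕ, t ^ k ≤ ‖M ^ k‖ := by
    intro k
    have hsum : 0 < ∑ j, v j := Finset.sum_pos (fun j _ => hv j) Finset.univ_nonempty
    have hrow : ∀ i, ∑ j, (S ^ k) i j ≤ ‖M ^ k‖ := by
      intro i
      have hMk : M ^ k = (S ^ k).map (algebraMap ℝ ℂ) := (Matrix.map_pow S (algebraMap ℝ ℂ) k).symm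
      have h2 : ∑ j, ‖(M ^ k) i j‖₊ ≤ ‖M ^ k‖₊ := by
        rw [Matrix.linfty_opNNNorm_def]
        exact Finset.le_sup (f := fun i => ∑ j, ‖(M ^ k) i j‖₊) (Finset.mem_univ i)
      have h3 : ∑ j, ‖(M ^ k) i j‖ ≤ ‖M ^ k‖ := by
        have h4 := NNReal.coe_le_coe.mpr h2
        rw [NNReal.coe_sum] at h4
        exact h4
      refine le_trans (Finset.sum_le_sum fun j _ => ?_) h3
      rw [hMk]
      simpa using le_abs_self ((S ^ k) i j)
    have : t ^ k * ∑ j, v j ≤ ‖M ^ k‖ * ∑ j, v j := by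
      calc t ^ k * ∑ j, v j ≤ ∑ j, (v ᵥ* S ^ k) j := by
            rw [Finset.mul_sum]
            exact Finset.sum_le_sum fun j _ => hpow k j
        _ = ∑ i, v i * ∑ j, (S ^ k) i j := by
            simp only [Matrix.vecMul, dotProduct, Finset.mul_sum]
            exact Finset.sum_comm
        _ ≤ ∑ i, v i * ‖M ^ k‖ :=
            Finset.sum_le_sum fun i _ => mul_le_mul_of_nonneg_left (hrow i) (hv i).le
        _ = _ := by rw [← Finset.sum_mul, mul_comm]
    exact le_of_mul_le_mul_right this hsum
  have hlim := spectrum.pow_norm_pow_one_div_tendsto_nhds_spectralRadius M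
  rw [hrad] at hlim
  have hge : ENNReal.ofReal t ≤ 1 := by
    refine ge_of_tendsto hlim ?_
    filter_upwards [Filter.eventually_gt_atTop 0] with k hk
    refine ENNReal.ofReal_le_ofReal ?_
    calc t = (t ^ k) ^ (1 / (k : ℝ)) := by
          rw [one_div, Real.pow_rpow_inv_natCast ht0 hk.ne']
      _ ≤ _ := Real.rpow_le_rpow (by positivity) (hnorm k) (by positivity)
  rw [ENNReal.ofReal_le_one] at hge
  linarith

section Doeblin

variable {ι : Type*} [Fintype ι]

theorem sum_sub_lower_bound_le {A B : Matrix ι ι ℝ} {p x z : ι → ℝ} {κ R m : ℝ}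
    (hκ : 0 < κ) (hκ1 : κ ≤ 1)
    (hA : ∀ i j, 0 ≤ A i j) (hB : ∀ i j, 0 ≤ B i j)
    (hA1 : ∀ i, ∑ j, A i j ≤ 1) (hB1 : ∀ i, ∑ j, B i j ≤ 1)
    (hp0 : ∀ i, 0 ≤ p i) (hp1 : ∀ i, p i ≤ 1)
    (hpA : ∀ i j, κ / Fintype.card ι ≤ p i * A i j)
    (hpB : ∀ i j, κ / Fintype.card ι ≤ p i * B i j)
    (hx : ∀ i, (1 - p i) * (B *ᵥ x) i + p i * (A *ᵥ z) i - R ≤ x i)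
    (hz : ∀ i, (1 - p i) * (A *ᵥ z) i + p i * (B *ᵥ x) i - R ≤ z i)
    (hm : m ≤ 0) (hmx : ∀ i, m ≤ x i) (hmz : ∀ i, m ≤ z i) {i₀ : ι} (hi₀ : x i₀ = m) :
    κ ^ 2 * ∑ j, (x j - m) ≤ 2 * R * Fintype.card ι ∧
      κ ^ 2 * ∑ j, (z j - m) ≤ 2 * R * Fintype.card ι := by
  have hN : (0 : ℝ) < Fintype.card ι := by
    have : Nonempty ι := ⟨i₀⟩
    exact_mod_cast Fintype.card_pos
  have low : ∀ (M : Matrix ι ι ℝ) (y : ι → ℝ), (∀ i j, 0 ≤ M i j) → (∀ i, ∑ j, M i j ≤ 1) →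
      (∀ i, m ≤ y i) → ∀ i, m ≤ (M *ᵥ y) i := by
    intro M y hM hM1 hy i
    calc m ≤ (∑ j, M i j) * m := by nlinarith [hM1 i]
      _ ≤ _ := by
        rw [Finset.sum_mul]
        exact Finset.sum_le_sum fun j _ => mul_le_mul_of_nonneg_left (hy j) (hM i j)
  have low' : ∀ (M : Matrix ι ι ℝ) (y : ι → ℝ),
      (∀ i, ∑ j, M i j ≤ 1) → (∀ i j, κ / Fintype.card ι ≤ p i * M i j) →
      (∀ i, m ≤ y i) → ∀ i,
        p i * m + κ / Fintype.card ι * ∑ j, (y j - m) ≤ p i * (M *ᵥ y) i := by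
    intro M y hM1 hpM hy i
    have h1 : p i * m ≤ p i * ((∑ j, M i j) * m) :=
      mul_le_mul_of_nonneg_left (by nlinarith [hM1 i]) (hp0 i)
    have h2 : κ / Fintype.card ι * ∑ j, (y j - m) ≤ ∑ j, p i * M i j * (y j - m) := by
      rw [Finset.mul_sum]
      exact Finset.sum_le_sum fun j _ =>
        mul_le_mul_of_nonneg_right (hpM i j) (sub_nonneg.mpr (hy j))
    have h3 : ∑ j, p i * M i j * (y j - m) = p i * (M *ᵥ y) i - p i * ((∑ j, M i j) * m) := by
      simp only [Matrix.mulVec, dotProduct, Finset.mul_sum, Finset.sum_mul,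
        ← Finset.sum_sub_distrib]
      exact Finset.sum_congr rfl fun j _ => by ring
    linarith
  set N : ℝ := (Fintype.card ι : ℝ)
  set X := ∑ j, (x j - m)
  set Z := ∑ j, (z j - m)
  have hZ0 : 0 ≤ Z := Finset.sum_nonneg fun j _ => sub_nonneg.mpr (hmz j)
  have hx' : κ / N * Z ≤ R := by
    have h1 := hx i₀
    have h2 := low' A z hA1 hpA hmz i₀
    have h3 := mul_le_mul_of_nonneg_left (low B x hB hB1 hmx i₀) (sub_nonneg.mpr (hp1 i₀))
    rw [hi₀] at h1
    linarith
  have hz' : ∀ i, κ / N * X - R ≤ z i - m := by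
    intro i
    have h1 := hz i
    have h2 := low' B x hB1 hpB hmx i
    have h3 := mul_le_mul_of_nonneg_left (low A z hA hA1 hmz i) (sub_nonneg.mpr (hp1 i))
    linarith
  have hsum : κ * X - N * R ≤ Z := by
    have h := Finset.sum_le_sum fun i (_ : i ∈ Finset.univ) => hz' i
    rw [Finset.sum_const, Finset.card_univ, nsmul_eq_mul] at h
    have h' : N * (κ / N * X - R) = κ * X - N * R := by field_simp
    change N * (κ / N * X - R) ≤ Z at h
    linarith
  have hκZ : κ * Z ≤ R * N := by
    rw [div_mul_eq_mul_div, div_le_iff₀ hN] at hx'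
    exact hx'
  have hR : 0 ≤ R * N := le_trans (by positivity) hκZ
  constructor <;> nlinarith

/-- Doeblin-type estimate: a solution of `w = M w + ρ`, with `M` a sub-Markov operator on two
copies of `ι` that swaps the copies with probability `p`, is bounded by `ρ` if `w` takes both
nonnegative and nonpositive values. -/
theorem abs_le_of_minorization {A B : Matrix ι ι ℝ} {p x z : ι → ℝ} {κ R : ℝ}
    (hκ : 0 < κ) (hκ1 : κ ≤ 1)
    (hA : ∀ i j, 0 ≤ A i j) (hB : ∀ i j, 0 ≤ B i j)
    (hA1 : ∀ i, ∑ j, A i j ≤ 1) (hB1 : ∀ i, ∑ j, B i j ≤ 1)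
    (hp0 : ∀ i, 0 ≤ p i) (hp1 : ∀ i, p i ≤ 1)
    (hpA : ∀ i j, κ / Fintype.card ι ≤ p i * A i j)
    (hpB : ∀ i j, κ / Fintype.card ι ≤ p i * B i j)
    (hx : ∀ i, |x i - ((1 - p i) * (B *ᵥ x) i + p i * (A *ᵥ z) i)| ≤ R)
    (hz : ∀ i, |z i - ((1 - p i) * (A *ᵥ z) i + p i * (B *ᵥ x) i)| ≤ R)
    (hneg : ∃ k, Sum.elim x z k ≤ 0) (hpos : ∃ k, 0 ≤ Sum.elim x z k) (k : ι ⊕ ι) :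
    |Sum.elim x z k| ≤ 4 * R / κ ^ 2 := by
  have low : ∀ x z : ι → ℝ,
      (∀ i, |x i - ((1 - p i) * (B *ᵥ x) i + p i * (A *ᵥ z) i)| ≤ R) →
      (∀ i, |z i - ((1 - p i) * (A *ᵥ z) i + p i * (B *ᵥ x) i)| ≤ R) →
      (∃ k, Sum.elim x z k ≤ 0) → ∃ m ≤ 0, (∀ k, m ≤ Sum.elim x z k) ∧
        κ ^ 2 * ∑ j, (x j - m) ≤ 2 * R * Fintype.card ι := by
    rintro x z hx hz ⟨l, hl⟩
    have : Nonempty (ι ⊕ ι) := ⟨l⟩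
    obtain ⟨k, hk⟩ := Finite.exists_min (Sum.elim x z)
    refine ⟨_, (hk l).trans hl, hk, ?_⟩
    have hx' := fun i => (abs_le.mp (hx i)).1
    have hz' := fun i => (abs_le.mp (hz i)).1
    rcases k with i₀ | i₀
    · exact (sum_sub_lower_bound_le (x := x) (z := z) hκ hκ1 hA hB hA1 hB1 hp0 hp1 hpA hpB
        (fun i => by linarith [hx' i]) (fun i => by linarith [hz' i]) ((hk l).trans hl)
        (fun i => hk (Sum.inl i)) (fun i => hk (Sum.inr i)) rfl).1
    · exact (sum_sub_lower_bound_le (x := z) (z := x) hκ hκ1 hB hA hB1 hA1 hp0 hp1 hpB hpA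
        (fun i => by linarith [hz' i]) (fun i => by linarith [hx' i]) ((hk l).trans hl)
        (fun i => hk (Sum.inr i)) (fun i => hk (Sum.inl i)) rfl).2
  have hN : (0 : ℝ) < Fintype.card ι := by
    have : Nonempty ι := ⟨k.elim id id⟩
    exact_mod_cast Fintype.card_pos
  obtain ⟨m, hm0, hm, hmX⟩ := low x z hx hz hneg
  obtain ⟨m', hm0', hm', hmX'⟩ := low (-x) (-z)
    (fun i => by
      rw [← abs_neg]; convert hx i using 2; simp only [Matrix.mulVec_neg, Pi.neg_apply]; ring)
    (fun i => by
      rw [← abs_neg]; convert hz i using 2; simp only [Matrix.mulVec_neg, Pi.neg_apply]; ring)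
    (by
      obtain ⟨l, hl⟩ := hpos
      exact ⟨l, by rcases l with l | l <;> simpa using hl⟩)
  have htot : ∑ j, (x j - m) + ∑ j, ((-x) j - m') = Fintype.card ι * (-m - m') := by
    rw [← Finset.sum_add_distrib]
    simp only [Pi.neg_apply]
    rw [Finset.sum_congr rfl fun j _ => (by ring : x j - m + (-x j - m') = -m - m')]
    rw [Finset.sum_const, Finset.card_univ, nsmul_eq_mul]
  have hspread : κ ^ 2 * (-m - m') ≤ 4 * R := by
    refine le_of_mul_le_mul_right ?_ hN
    calc κ ^ 2 * (-m - m') * Fintype.card ι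
        = κ ^ 2 * ∑ j, (x j - m) + κ ^ 2 * ∑ j, ((-x) j - m') := by rw [← mul_add, htot]; ring
      _ ≤ 4 * R * Fintype.card ι := by linarith
  have hk1 := hm k
  have hk2 : m' ≤ -Sum.elim x z k := by
    have := hm' k
    rcases k with k | k <;> simpa using this
  refine le_trans (b := -m - m') (abs_le.mpr ⟨by linarith, by linarith⟩) ?_
  rw [le_div_iff₀ (by positivity)]
  linarith

theorem abs_le_of_contraction {A B : Matrix ι ι ℝ} {p x z : ι → ℝ} {δ R : ℝ} (hδ : 0 < δ)
    (hA : ∀ i j, 0 ≤ A i j) (hB : ∀ i j, 0 ≤ B i j)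
    (hA1 : ∀ i, ∑ j, A i j ≤ 1 - δ) (hB1 : ∀ i, ∑ j, B i j ≤ 1 - δ)
    (hp0 : ∀ i, 0 ≤ p i) (hp1 : ∀ i, p i ≤ 1)
    (hx : ∀ i, |x i - ((1 - p i) * (B *ᵥ x) i + p i * (A *ᵥ z) i)| ≤ R)
    (hz : ∀ i, |z i - ((1 - p i) * (A *ᵥ z) i + p i * (B *ᵥ x) i)| ≤ R) (k : ι ⊕ ι) :
    |Sum.elim x z k| ≤ R / δ := by
  have : Nonempty (ι ⊕ ι) := ⟨k⟩
  obtain ⟨l, hl⟩ := Finite.exists_max (fun k => |Sum.elim x z k|)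
  refine (hl k).trans ?_
  set W := |Sum.elim x z l| with hW
  have hW0 : 0 ≤ W := abs_nonneg _
  have hbound : ∀ (M : Matrix ι ι ℝ) (y : ι → ℝ), (∀ i j, 0 ≤ M i j) →
      (∀ i, ∑ j, M i j ≤ 1 - δ) → (∀ i, |y i| ≤ W) → ∀ i, |(M *ᵥ y) i| ≤ (1 - δ) * W := by
    intro M y hM hM1 hy i
    calc |(M *ᵥ y) i| ≤ ∑ j, |M i j * y j| := Finset.abs_sum_le_sum_abs _ _
      _ ≤ ∑ j, M i j * W := by
          refine Finset.sum_le_sum fun j _ => ?_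
          rw [abs_mul, abs_of_nonneg (hM i j)]
          exact mul_le_mul_of_nonneg_left (hy j) (hM i j)
      _ ≤ _ := by
          rw [← Finset.sum_mul]
          exact mul_le_mul_of_nonneg_right (hM1 i) hW0
  have hAz := hbound A z hA hA1 fun i => hl (Sum.inr i)
  have hBx := hbound B x hB hB1 fun i => hl (Sum.inl i)
  have convex : ∀ p s t y : ℝ, 0 ≤ p → p ≤ 1 → |s| ≤ (1 - δ) * W → |t| ≤ (1 - δ) * W →
      |y - ((1 - p) * s + p * t)| ≤ R → |y| ≤ (1 - δ) * W + R := by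
    intro p s t y hp0 hp1 hs ht hy
    rw [abs_le] at *
    have hp1' := sub_nonneg.mpr hp1
    constructor <;> nlinarith [mul_le_mul_of_nonneg_left hs.1 hp1',
      mul_le_mul_of_nonneg_left hs.2 hp1', mul_le_mul_of_nonneg_left ht.1 hp0,
      mul_le_mul_of_nonneg_left ht.2 hp0]
  have hmain : W ≤ (1 - δ) * W + R := by
    rcases l with i | i
    · exact convex _ _ _ _ (hp0 i) (hp1 i) (hBx i) (hAz i) (hx i)
    · exact convex _ _ _ _ (hp0 i) (hp1 i) (hAz i) (hBx i) (hz i)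
  rw [le_div_iff₀ hδ]
  linarith

end Doeblin

/-- The Dyson equation written in terms of `a = η + S v₂`, `b = η + Sᵗ v₁` and the common ratio
`u = v₁ / b = v₂ / a = 1 / (a b + τ)`. -/
structure DysonCoeffs {n : ℕ} (S : Matrix (Fin n) (Fin n) ℝ) (τ η : ℝ)
    (v₁ v₂ a b u : Fin n → ℝ) : Prop where
  a_eq : ∀ i, a i = η + (S *ᵥ v₂) i
  b_eq : ∀ i, b i = η + (Sᵀ *ᵥ v₁) i
  a_pos : ∀ i, 0 < a i
  b_pos : ∀ i, 0 < b i
  u_pos : ∀ i, 0 < u i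
  v₁_eq : ∀ i, v₁ i = u i * b i
  v₂_eq : ∀ i, v₂ i = u i * a i
  u_eq : ∀ i, u i * (a i * b i + τ) = 1
  sum_eq : ∑ i, v₁ i = ∑ i, v₂ i

theorem IsDysonSolution.exists_coeffs {n : ℕ} {S : Matrix (Fin n) (Fin n) ℝ} {τ η : ℝ}
    {v₁ v₂ : Fin n → ℝ} (h : IsDysonSolution S τ η v₁ v₂) (hS : ∀ i j, 0 ≤ S i j)
    (hτ : 0 ≤ τ) (hη : 0 < η) : ∃ a b u, DysonCoeffs S τ η v₁ v₂ a b u := by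
  obtain ⟨h1, h2, e1, e2⟩ := h
  have ha : ∀ i, 0 < η + (S *ᵥ v₂) i := fun i =>
    add_pos_of_pos_of_nonneg hη
      (Finset.sum_nonneg (s := Finset.univ) fun j _ => mul_nonneg (hS i j) (h2 j).le)
  have hb : ∀ i, 0 < η + (Sᵀ *ᵥ v₁) i := fun i =>
    add_pos_of_pos_of_nonneg hη
      (Finset.sum_nonneg (s := Finset.univ) fun j _ => mul_nonneg (hS j i) (h1 j).le)
  have hv₁ : ∀ i, v₁ i = ((η + (S *ᵥ v₂) i) * (η + (Sᵀ *ᵥ v₁) i) + τ)⁻¹ * (η + (Sᵀ *ᵥ v₁) i) := by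
    intro i
    have hai := ha i
    have hbi := hb i
    have := e1 i
    generalize η + (S *ᵥ v₂) i = a at *
    generalize η + (Sᵀ *ᵥ v₁) i = b at *
    rw [← one_div_one_div (v₁ i), this]
    field_simp
  have hv₂ : ∀ i, v₂ i = ((η + (S *ᵥ v₂) i) * (η + (Sᵀ *ᵥ v₁) i) + τ)⁻¹ * (η + (S *ᵥ v₂) i) := by
    intro i
    have hai := ha i
    have hbi := hb i
    have := e2 i
    generalize η + (S *ᵥ v₂) i = a at *
    generalize η + (Sᵀ *ᵥ v₁) i = b at *
    rw [← one_div_one_div (v₂ i), this]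
    field_simp
  have hu : ∀ i, 0 < (η + (S *ᵥ v₂) i) * (η + (Sᵀ *ᵥ v₁) i) + τ := fun i =>
    add_pos_of_pos_of_nonneg (mul_pos (ha i) (hb i)) hτ
  refine ⟨fun i => η + (S *ᵥ v₂) i, fun i => η + (Sᵀ *ᵥ v₁) i,
    fun i => ((η + (S *ᵥ v₂) i) * (η + (Sᵀ *ᵥ v₁) i) + τ)⁻¹, fun i => rfl, fun i => rfl, ha, hb,
    fun i => inv_pos.mpr (hu i), hv₁, hv₂, fun i => inv_mul_cancel₀ (hu i).ne', ?_⟩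
  have hcross : ∀ i, v₁ i * (η + (S *ᵥ v₂) i) = v₂ i * (η + (Sᵀ *ᵥ v₁) i) := by
    intro i
    have e1' := hv₁ i
    have e2' := hv₂ i
    generalize η + (S *ᵥ v₂) i = a at *
    generalize η + (Sᵀ *ᵥ v₁) i = b at *
    rw [e1', e2']
    ring
  have hsum := Finset.sum_congr (rfl : (Finset.univ : Finset (Fin n)) = _) fun i _ => hcross i
  simp only [mul_add, Finset.sum_add_distrib, ← Finset.sum_mul] at hsum
  have hadj : ∑ i, v₁ i * (S *ᵥ v₂) i = ∑ i, v₂ i * (Sᵀ *ᵥ v₁) i := by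
    simp only [Matrix.mulVec, dotProduct, Finset.mul_sum, Matrix.transpose_apply]
    rw [Finset.sum_comm]
    exact Finset.sum_congr rfl fun i _ => Finset.sum_congr rfl fun j _ => by ring
  rw [hadj] at hsum
  exact mul_right_cancel₀ hη.ne' (add_right_cancel hsum)

/-- The a priori bounds on the solution of the Dyson equation that enter the stability proof. -/
structure DysonBounds {n : ℕ} (η : ℝ) (v₁ v₂ a b u : Fin n → ℝ) (w K : ℝ) : Prop where
  w_pos : 0 < w
  u_le : ∀ i, u i ≤ K
  v₁_le : ∀ i, v₁ i ≤ K
  v₂_le : ∀ i, v₂ i ≤ K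
  le_v₁ : ∀ i, w ≤ v₁ i
  le_v₂ : ∀ i, w ≤ v₂ i
  v₁_le_mul : ∀ i, v₁ i ≤ K * w
  v₂_le_mul : ∀ i, v₂ i ≤ K * w
  alternative : (∀ i, a i ≤ K * η ∧ b i ≤ K * η) ∨ (∀ i, 1 / K ≤ v₁ i ∧ 1 / K ≤ v₂ i)

theorem div_le_mulVec_and_mulVec_le {n : ℕ} {M : Matrix (Fin n) (Fin n) ℝ}
    {D : ℝ} (hM : ∀ i j, 1 / D / n ≤ M i j ∧ M i j ≤ D / n) {y : Fin n → ℝ} (hy : ∀ i, 0 ≤ y i)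
    (i : Fin n) :
    1 / D * ((∑ j, y j) / n) ≤ (M *ᵥ y) i ∧ (M *ᵥ y) i ≤ D * ((∑ j, y j) / n) := by
  have h1 : 1 / D * ((∑ j, y j) / n) = ∑ j, 1 / D / n * y j := by
    rw [← Finset.mul_sum]; ring
  have h2 : D * ((∑ j, y j) / n) = ∑ j, D / n * y j := by
    rw [← Finset.mul_sum]; ring
  rw [h1, h2]
  simp only [Matrix.mulVec, dotProduct]
  exact ⟨Finset.sum_le_sum fun j _ => mul_le_mul_of_nonneg_right (hM i j).1 (hy j),
    Finset.sum_le_sum fun j _ => mul_le_mul_of_nonneg_right (hM i j).2 (hy j)⟩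

theorem DysonCoeffs.exists_bounds {n : ℕ} (hn : 1 ≤ n) {S : Matrix (Fin n) (Fin n) ℝ} {D τ η : ℝ}
    {v₁ v₂ a b u : Fin n → ℝ} (h : DysonCoeffs S τ η v₁ v₂ a b u) (hD : 1 ≤ D)
    (hS : ∀ i j, 1 / D / n ≤ S i j ∧ S i j ≤ D / n) (hr : specRad S = 1)
    (hτ0 : 0 ≤ τ) (hη : 0 < η) (hτ : τ ≤ 1 - 1 / D ∨ 1 + 1 / D ≤ τ) :
    ∃ w, DysonBounds η v₁ v₂ a b u w (5 * D ^ 13) := by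
  have : NeZero n := ⟨by omega⟩
  have hn0 : (0 : ℝ) < n := by exact_mod_cast hn
  have hD0 : 0 < D := by linarith
  have hDpow : ∀ i j : ℕ, i ≤ j → D ^ i ≤ D ^ j := fun i j hij => pow_le_pow_right₀ hD hij
  have hS0 : ∀ i j, 0 ≤ S i j := fun i j => le_trans (by positivity) (hS i j).1
  have v₁_pos : ∀ i, 0 < v₁ i := fun i => by
    rw [h.v₁_eq]; exact mul_pos (h.u_pos i) (h.b_pos i)
  have v₂_pos : ∀ i, 0 < v₂ i := fun i => by
    rw [h.v₂_eq]; exact mul_pos (h.u_pos i) (h.a_pos i)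
  obtain ⟨m, hm⟩ : ∃ m, m = (∑ j, v₂ j) / n := ⟨_, rfl⟩
  have hm' : m = (∑ j, v₁ j) / n := by rw [hm, h.sum_eq]
  have hm0 : 0 < m := by
    rw [hm]; exact div_pos (Finset.sum_pos (fun j _ => v₂_pos j) Finset.univ_nonempty) hn0
  have hD1 : 1 / D ≤ 1 := (div_le_one hD0).mpr hD
  obtain ⟨θ, hθ⟩ : ∃ θ, θ = η + m := ⟨_, rfl⟩
  have hθ0 : 0 < θ := by rw [hθ]; positivity
  have ha1 : ∀ i, 1 / D * θ ≤ a i := fun i => by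
    have := (div_le_mulVec_and_mulVec_le hS (fun j => (v₂_pos j).le) i).1
    rw [← hm] at this
    rw [h.a_eq, hθ]; nlinarith
  have ha2 : ∀ i, a i ≤ D * θ := fun i => by
    have := (div_le_mulVec_and_mulVec_le hS (fun j => (v₂_pos j).le) i).2
    rw [← hm] at this
    rw [h.a_eq, hθ]; nlinarith
  have hST : ∀ i j, 1 / D / n ≤ Sᵀ i j ∧ Sᵀ i j ≤ D / n := fun i j => hS j i
  have hb1 : ∀ i, 1 / D * θ ≤ b i := fun i => by
    have := (div_le_mulVec_and_mulVec_le hST (fun j => (v₁_pos j).le) i).1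
    rw [← hm'] at this
    rw [h.b_eq, hθ]; nlinarith
  have hb2 : ∀ i, b i ≤ D * θ := fun i => by
    have := (div_le_mulVec_and_mulVec_le hST (fun j => (v₁_pos j).le) i).2
    rw [← hm'] at this
    rw [h.b_eq, hθ]; nlinarith
  have hab1 : ∀ i, θ ^ 2 / D ^ 2 ≤ a i * b i := fun i => by
    calc θ ^ 2 / D ^ 2 = (1 / D * θ) * (1 / D * θ) := by ring
      _ ≤ _ := mul_le_mul (ha1 i) (hb1 i) (by positivity) (h.a_pos i).le
  have hab2 : ∀ i, a i * b i ≤ D ^ 2 * θ ^ 2 := fun i => by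
    calc a i * b i ≤ (D * θ) * (D * θ) :=
          mul_le_mul (ha2 i) (hb2 i) (h.b_pos i).le (by positivity)
      _ = _ := by ring
  have u_eq : ∀ i, u i = 1 / (a i * b i + τ) := fun i => by
    have := mul_pos (h.a_pos i) (h.b_pos i)
    rw [eq_div_iff (by positivity), h.u_eq]
  obtain ⟨t, ht⟩ : ∃ t, t = 1 / (D ^ 2 * θ ^ 2 + τ) := ⟨_, rfl⟩
  have ht0 : 0 < t := by rw [ht]; positivity
  have hu1 : ∀ i, t ≤ u i := fun i => by
    have := mul_pos (h.a_pos i) (h.b_pos i)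
    rw [u_eq, ht]
    exact one_div_le_one_div_of_le (by positivity) (by linarith [hab2 i])
  have hu2 : ∀ i, u i ≤ D ^ 4 * t := fun i => by
    have := mul_pos (h.a_pos i) (h.b_pos i)
    rw [u_eq, ht, mul_one_div, div_le_div_iff₀ (by positivity) (by positivity)]
    have h1 : D ^ 2 * θ ^ 2 ≤ D ^ 4 * (a i * b i) := by
      calc D ^ 2 * θ ^ 2 = D ^ 4 * (θ ^ 2 / D ^ 2) := by field_simp
        _ ≤ _ := mul_le_mul_of_nonneg_left (hab1 i) (by positivity)
    have h2 : τ ≤ D ^ 4 * τ := le_mul_of_one_le_left hτ0 (one_le_pow₀ hD)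
    linarith
  obtain ⟨w, hw⟩ : ∃ w, w = t * (1 / D * θ) := ⟨_, rfl⟩
  have hw0 : 0 < w := by rw [hw]; positivity
  have hwD : D ^ 6 * w = D ^ 4 * t * (D * θ) := by rw [hw]; field_simp
  have le_v₁ : ∀ i, w ≤ v₁ i := fun i => by
    rw [h.v₁_eq, hw]; exact mul_le_mul (hu1 i) (hb1 i) (by positivity) (h.u_pos i).le
  have le_v₂ : ∀ i, w ≤ v₂ i := fun i => by
    rw [h.v₂_eq, hw]; exact mul_le_mul (hu1 i) (ha1 i) (by positivity) (h.u_pos i).le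
  have v₁_le : ∀ i, v₁ i ≤ D ^ 6 * w := fun i => by
    rw [h.v₁_eq, hwD]; exact mul_le_mul (hu2 i) (hb2 i) (h.b_pos i).le (by positivity)
  have v₂_le : ∀ i, v₂ i ≤ D ^ 6 * w := fun i => by
    rw [h.v₂_eq, hwD]; exact mul_le_mul (hu2 i) (ha2 i) (h.a_pos i).le (by positivity)
  have m_le : m ≤ D ^ 6 * w := by
    rw [hm, div_le_iff₀ hn0]
    calc ∑ j, v₂ j ≤ ∑ _j : Fin n, D ^ 6 * w := Finset.sum_le_sum fun j _ => v₂_le j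
      _ = _ := by
        rw [Finset.sum_const, Finset.card_univ, Fintype.card_fin, nsmul_eq_mul, mul_comm]
  have habu : ∀ i, a i * b i * u i ≤ 1 := fun i => by
    nlinarith [h.u_eq i, mul_nonneg (h.u_pos i).le hτ0]
  have hDθ : D * θ = D ^ 2 * (1 / D * θ) := by field_simp
  have v₁_sq : ∀ i, v₁ i ^ 2 ≤ D ^ 2 * u i := fun i => by
    have h1 : b i ≤ D ^ 2 * a i := (hb2 i).trans <| by
      rw [hDθ]; exact mul_le_mul_of_nonneg_left (ha1 i) (by positivity)
    have hu := h.u_pos i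
    have hb := h.b_pos i
    calc v₁ i ^ 2 = u i ^ 2 * b i * b i := by rw [h.v₁_eq]; ring
      _ ≤ u i ^ 2 * b i * (D ^ 2 * a i) := mul_le_mul_of_nonneg_left h1 (by positivity)
      _ = D ^ 2 * u i * (a i * b i * u i) := by ring
      _ ≤ D ^ 2 * u i * 1 := mul_le_mul_of_nonneg_left (habu i) (by positivity)
      _ = _ := mul_one _
  have v₂_sq : ∀ i, v₂ i ^ 2 ≤ D ^ 2 * u i := fun i => by
    have h1 : a i ≤ D ^ 2 * b i := (ha2 i).trans <| by
      rw [hDθ]; exact mul_le_mul_of_nonneg_left (hb1 i) (by positivity)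
    have hu := h.u_pos i
    have ha := h.a_pos i
    calc v₂ i ^ 2 = u i ^ 2 * a i * a i := by rw [h.v₂_eq]; ring
      _ ≤ u i ^ 2 * a i * (D ^ 2 * b i) := mul_le_mul_of_nonneg_left h1 (by positivity)
      _ = D ^ 2 * u i * (a i * b i * u i) := by ring
      _ ≤ D ^ 2 * u i * 1 := mul_le_mul_of_nonneg_left (habu i) (by positivity)
      _ = _ := mul_one _
  have sq_bound : ∀ (x s : ℝ) (k : ℕ), x ^ 2 ≤ D ^ 2 * s → s ≤ D ^ (2 * k) → x ≤ D ^ (k + 1) := by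
    intro x s k h1 h2
    refine le_of_sq_le_sq ?_ (by positivity)
    calc x ^ 2 ≤ D ^ 2 * s := h1
      _ ≤ D ^ 2 * D ^ (2 * k) := mul_le_mul_of_nonneg_left h2 (by positivity)
      _ = _ := by ring
  have hDK : ∀ j ≤ 13, D ^ j ≤ 5 * D ^ 13 := fun j hj => by
    linarith [hDpow j 13 hj, pow_pos hD0 13]
  have hwK : D ^ 6 * w ≤ 5 * D ^ 13 * w := mul_le_mul_of_nonneg_right (hDK 6 (by norm_num)) hw0.le
  have hSv : ∀ i, (Sᵀ *ᵥ v₁) i = (a i * b i + τ) * v₁ i - η := fun i => by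
    have h1 := h.u_eq i
    have h2 := h.v₁_eq i
    have h3 := h.b_eq i
    have : (a i * b i + τ) * v₁ i = b i := by
      rw [h2]; linear_combination b i * h1
    linarith
  have finish : ∀ k : ℕ, 2 * k ≤ 13 → k + 1 ≤ 13 → (∀ i, u i ≤ D ^ (2 * k)) →
      ((∀ i, a i ≤ 5 * D ^ 13 * η ∧ b i ≤ 5 * D ^ 13 * η) ∨
        (∀ i, 1 / (5 * D ^ 13) ≤ v₁ i ∧ 1 / (5 * D ^ 13) ≤ v₂ i)) →
      ∃ w, DysonBounds η v₁ v₂ a b u w (5 * D ^ 13) := fun k hk hk1 hu halt =>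
    ⟨w, hw0, fun i => (hu i).trans (hDK _ hk),
      fun i => (sq_bound _ _ _ (v₁_sq i) (hu i)).trans (hDK _ hk1),
      fun i => (sq_bound _ _ _ (v₂_sq i) (hu i)).trans (hDK _ hk1),
      le_v₁, le_v₂, fun i => (v₁_le i).trans hwK, fun i => (v₂_le i).trans hwK, halt⟩
  by_cases hη1 : 1 ≤ η
  · have ha : ∀ i, η ≤ a i := fun i => by
      rw [h.a_eq]
      have := (div_le_mulVec_and_mulVec_le hS (fun j => (v₂_pos j).le) i).1
      have h0 : 0 ≤ 1 / D * ((∑ j, v₂ j) / n) := by rw [← hm]; positivity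
      linarith
    have hb : ∀ i, η ≤ b i := fun i => by
      rw [h.b_eq]
      have := (div_le_mulVec_and_mulVec_le hST (fun j => (v₁_pos j).le) i).1
      have h0 : 0 ≤ 1 / D * ((∑ j, v₁ j) / n) := by rw [← hm']; positivity
      linarith
    have hu : ∀ i, u i ≤ 1 := fun i => by
      have := h.u_eq i
      have hab : 1 ≤ a i * b i := by nlinarith [ha i, hb i]
      nlinarith [h.u_pos i]
    have hv : ∀ i, v₂ i ≤ 1 := fun i => by
      have := habu i
      have hb1 : 1 ≤ b i := hη1.trans (hb i)
      rw [h.v₂_eq]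
      nlinarith [mul_pos (h.a_pos i) (h.u_pos i)]
    have hm1 : m ≤ η := by
      rw [hm, div_le_iff₀ hn0]
      calc ∑ j, v₂ j ≤ ∑ _j : Fin n, (1 : ℝ) := Finset.sum_le_sum fun j _ => hv j
        _ = n := by simp
        _ ≤ η * n := le_mul_of_one_le_left hn0.le hη1
    have hθη : D * θ ≤ 5 * D ^ 13 * η := by
      calc D * θ ≤ D * (2 * η) := mul_le_mul_of_nonneg_left (by linarith) hD0.le
        _ = 2 * D ^ 1 * η := by ring
        _ ≤ _ := mul_le_mul_of_nonneg_right
          (by linarith [hDpow 1 13 (by norm_num), pow_pos hD0 13]) hη.le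
    exact finish 0 (by norm_num) (by norm_num) (by simpa using hu)
      (Or.inl fun i => ⟨(ha2 i).trans hθη, (hb2 i).trans hθη⟩)
  rcases hτ with hτ | hτ
  · obtain ⟨i, hi⟩ := exists_le_transpose_mulVec hn hS0 hr v₁_pos
    have hab : 1 / D ≤ a i * b i := by
      rw [hSv] at hi
      by_contra! hlt
      nlinarith [v₁_pos i]
    have hθD : 1 / D ^ 3 ≤ θ ^ 2 := by
      have := hab.trans (hab2 i)
      rw [div_le_iff₀ (by positivity)] at this ⊢
      calc 1 ≤ _ := this
        _ = _ := by ring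
    have hu : ∀ i, u i ≤ D ^ (2 * 3) := fun i => by
      have hab' : 1 / D ^ 5 ≤ a i * b i := by
        refine le_trans ?_ (hab1 i)
        calc 1 / D ^ 5 = (1 / D ^ 3) / D ^ 2 := by field_simp
          _ ≤ _ := div_le_div_of_nonneg_right hθD (by positivity)
      calc u i ≤ D ^ 5 := by
            have hab0 := mul_pos (h.a_pos i) (h.b_pos i)
            rw [u_eq, div_le_iff₀ (by positivity)]
            rw [div_le_iff₀ (by positivity)] at hab'
            nlinarith [mul_nonneg (pow_pos hD0 5).le hτ0]
        _ ≤ _ := hDpow _ _ (by norm_num)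
    have hm4 : m ≤ D ^ 4 := by
      rw [hm, div_le_iff₀ hn0]
      calc ∑ j, v₂ j ≤ ∑ _j : Fin n, D ^ 4 :=
            Finset.sum_le_sum fun j _ => sq_bound _ _ _ (v₂_sq j) (hu j)
        _ = _ := by
          rw [Finset.sum_const, Finset.card_univ, Fintype.card_fin, nsmul_eq_mul, mul_comm]
    have hθ2 : θ ≤ 2 * D ^ 4 := by linarith [one_le_pow₀ hD (n := 4), not_le.mp hη1]
    have hθ1 : 1 / D ^ 2 ≤ θ := by
      refine le_of_sq_le_sq (le_trans ?_ hθD) hθ0.le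
      rw [div_pow, one_pow, ← pow_mul]
      exact one_div_le_one_div_of_le (by positivity) (hDpow _ _ (by norm_num))
    have hden : D ^ 2 * θ ^ 2 + τ ≤ 5 * D ^ 10 := by
      have h1 : θ ^ 2 ≤ (2 * D ^ 4) ^ 2 := pow_le_pow_left₀ hθ0.le hθ2 2
      have h2 : D ^ 2 * θ ^ 2 ≤ D ^ 2 * (2 * D ^ 4) ^ 2 :=
        mul_le_mul_of_nonneg_left h1 (by positivity)
      have h3 : D ^ 2 * (2 * D ^ 4) ^ 2 = 4 * D ^ 10 := by ring
      have h4 : τ ≤ 1 := hτ.trans (by linarith [one_div_pos.mpr hD0])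
      linarith [one_le_pow₀ hD (n := 10)]
    have hwlow : 1 / (5 * D ^ 13) ≤ w := by
      calc 1 / (5 * D ^ 13) = 1 / (5 * D ^ 10) * (1 / D * (1 / D ^ 2)) := by field_simp
        _ ≤ w := by
          rw [hw, ht]
          gcongr
    exact finish 3 (by norm_num) (by norm_num) hu
      (Or.inr fun i => ⟨hwlow.trans (le_v₁ i), hwlow.trans (le_v₂ i)⟩)
  · have hwη : w ≤ D * η := by
      by_contra! hlt
      have hle : ∀ i, (1 + 1 / D - η / w) * v₁ i ≤ (Sᵀ *ᵥ v₁) i := fun i => by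
        rw [hSv]
        have h1 : η ≤ η / w * v₁ i := by
          rw [div_mul_eq_mul_div, le_div_iff₀ hw0]
          exact mul_le_mul_of_nonneg_left (le_v₁ i) hη.le
        have h2 : (1 + 1 / D) * v₁ i ≤ (a i * b i + τ) * v₁ i :=
          mul_le_mul_of_nonneg_right
            (by linarith [mul_pos (h.a_pos i) (h.b_pos i)]) (v₁_pos i).le
        linarith
      have h1 := le_one_of_smul_le_transpose_mulVec hn hS0 hr v₁_pos hle
      have h2 : η / w < 1 / D := by
        rw [div_lt_div_iff₀ hw0 hD0]; linarith
      linarith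
    have hu : ∀ i, u i ≤ 1 := fun i => by
      have := h.u_eq i
      have hab := mul_pos (h.a_pos i) (h.b_pos i)
      nlinarith [h.u_pos i, one_div_pos.mpr hD0]
    have hθη : D * θ ≤ 5 * D ^ 13 * η := by
      have h1 : m ≤ D ^ 7 * η := m_le.trans <| by
        calc D ^ 6 * w ≤ D ^ 6 * (D * η) := mul_le_mul_of_nonneg_left hwη (by positivity)
          _ = _ := by ring
      calc D * θ ≤ D * (η + D ^ 7 * η) := mul_le_mul_of_nonneg_left (by linarith) hD0.le
        _ = (D ^ 1 + D ^ 8) * η := by ring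
        _ ≤ _ := mul_le_mul_of_nonneg_right
          (by linarith [hDpow 1 13 (by norm_num), hDpow 8 13 (by norm_num), pow_pos hD0 13]) hη.le
    exact finish 0 (by norm_num) (by norm_num) (by simpa using hu)
      (Or.inl fun i => ⟨(ha2 i).trans hθη, (hb2 i).trans hθη⟩)

/-- Stability of the linearized Dyson equation on the hyperplane `⟨h₁⟩ = ⟨h₂⟩`. -/
theorem DysonCoeffs.linear_stability {n : ℕ} {S : Matrix (Fin n) (Fin n) ℝ} {D K τ η w R : ℝ}
    {v₁ v₂ a b u h₁ h₂ : Fin n → ℝ} (h : DysonCoeffs S τ η v₁ v₂ a b u)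
    (hb : DysonBounds η v₁ v₂ a b u w K) (hK : 1 ≤ K) (hD : 1 ≤ D)
    (hS : ∀ i j, 1 / D / n ≤ S i j) (hτ : 0 ≤ τ) (hη : 0 < η)
    (h1 : ∀ i, |h₁ i + v₁ i ^ 2 * (S *ᵥ h₂) i - τ * u i ^ 2 * (Sᵀ *ᵥ h₁) i| ≤ R)
    (h2 : ∀ i, |h₂ i + v₂ i ^ 2 * (Sᵀ *ᵥ h₁) i - τ * u i ^ 2 * (S *ᵥ h₂) i| ≤ R)
    (hsum : ∑ i, h₁ i = ∑ i, h₂ i) (i : Fin n) :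
    |h₁ i| ≤ K * (K + 4 * (K ^ 2 * D) ^ 2) * R ∧ |h₂ i| ≤ K * (K + 4 * (K ^ 2 * D) ^ 2) * R := by
  have hK0 : 0 < K := by linarith
  have hD0 : 0 < D := by linarith
  have hR : 0 ≤ R := (abs_nonneg _).trans (h1 i)
  have hw := hb.w_pos
  have hS0 : ∀ i j, 0 ≤ S i j := fun i j => le_trans (by positivity) (hS i j)
  have v₁_pos : ∀ i, 0 < v₁ i := fun i => hw.trans_le (hb.le_v₁ i)
  have v₂_pos : ∀ i, 0 < v₂ i := fun i => hw.trans_le (hb.le_v₂ i)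
  set A : Matrix (Fin n) (Fin n) ℝ := Matrix.of fun i j => S i j * v₂ j / a i with hA
  set B : Matrix (Fin n) (Fin n) ℝ := Matrix.of fun i j => S j i * v₁ j / b i with hB
  set p : Fin n → ℝ := fun i => u i * a i * b i with hp
  set x : Fin n → ℝ := fun i => h₁ i / v₁ i with hx
  set z : Fin n → ℝ := fun i => -(h₂ i / v₂ i) with hz
  have hA0 : ∀ i j, 0 ≤ A i j := fun i j =>
    div_nonneg (mul_nonneg (hS0 i j) (v₂_pos j).le) (h.a_pos i).le
  have hB0 : ∀ i j, 0 ≤ B i j := fun i j =>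
    div_nonneg (mul_nonneg (hS0 j i) (v₁_pos j).le) (h.b_pos i).le
  have hArow : ∀ i, ∑ j, A i j = 1 - η / a i := fun i => by
    have ha := (h.a_pos i).ne'
    simp only [hA, Matrix.of_apply]
    rw [← Finset.sum_div, eq_sub_iff_add_eq, ← add_div, div_eq_one_iff_eq ha, h.a_eq, add_comm]
    rfl
  have hBrow : ∀ i, ∑ j, B i j = 1 - η / b i := fun i => by
    have hb := (h.b_pos i).ne'
    simp only [hB, Matrix.of_apply]
    rw [← Finset.sum_div, eq_sub_iff_add_eq, ← add_div, div_eq_one_iff_eq hb, h.b_eq, add_comm]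
    rfl
  have hAz : ∀ i, (A *ᵥ z) i = -((S *ᵥ h₂) i / a i) := fun i => by
    simp only [hA, hz, Matrix.mulVec, dotProduct, Matrix.of_apply, Finset.sum_div,
      ← Finset.sum_neg_distrib]
    refine Finset.sum_congr rfl fun j _ => ?_
    have := (v₂_pos j).ne'
    field_simp
  have hBx : ∀ i, (B *ᵥ x) i = (Sᵀ *ᵥ h₁) i / b i := fun i => by
    simp only [hB, hx, Matrix.mulVec, dotProduct, Matrix.of_apply, Finset.sum_div,
      Matrix.transpose_apply]
    refine Finset.sum_congr rfl fun j _ => ?_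
    have := (v₁_pos j).ne'
    field_simp
  have hp0 : ∀ i, 0 ≤ p i := fun i =>
    mul_nonneg (mul_nonneg (h.u_pos i).le (h.a_pos i).le) (h.b_pos i).le
  have hp' : ∀ i, 1 - p i = τ * u i := fun i => by
    simp only [hp]; linear_combination -h.u_eq i
  have hp1 : ∀ i, p i ≤ 1 := fun i => by
    linarith [hp' i, mul_nonneg hτ (h.u_pos i).le]
  have div_bound : ∀ s v : ℝ, w ≤ v → |s| ≤ R → |s / v| ≤ R / w := fun s v hv hs => by
    rw [abs_div, abs_of_pos (hw.trans_le hv)]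
    exact div_le_div₀ hR hs hw hv
  have hx' : ∀ i, |x i - ((1 - p i) * (B *ᵥ x) i + p i * (A *ᵥ z) i)| ≤ R / w := fun i => by
    convert div_bound _ _ (hb.le_v₁ i) (h1 i) using 2
    rw [hp', hAz, hBx]
    have ha := (h.a_pos i).ne'
    have hb := (h.b_pos i).ne'
    have hu := (h.u_pos i).ne'
    simp only [hx, hp, h.v₁_eq]
    field_simp
    ring
  have hz' : ∀ i, |z i - ((1 - p i) * (A *ᵥ z) i + p i * (B *ᵥ x) i)| ≤ R / w := fun i => by
    rw [← abs_neg]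
    convert div_bound _ _ (hb.le_v₂ i) (h2 i) using 2
    rw [hp', hAz, hBx]
    have ha := (h.a_pos i).ne'
    have hb := (h.b_pos i).ne'
    have hu := (h.u_pos i).ne'
    simp only [hz, hp, h.v₂_eq]
    field_simp
    ring
  have hbound : ∀ k, |Sum.elim x z k| ≤ (K + 4 * (K ^ 2 * D) ^ 2) * (R / w) := by
    intro k
    rcases hb.alternative with halt | halt
    · have hle : ∀ c : ℝ, 0 < c → c ≤ K * η → 1 - η / c ≤ 1 - 1 / K := fun c hc hcK => by
        have : 1 / K ≤ η / c := by rw [div_le_div_iff₀ hK0 hc]; linarith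
        linarith
      have := abs_le_of_contraction (one_div_pos.mpr hK0) hA0 hB0
        (fun i => (hArow i).trans_le (hle _ (h.a_pos i) (halt i).1))
        (fun i => (hBrow i).trans_le (hle _ (h.b_pos i) (halt i).2)) hp0 hp1 hx' hz' k
      refine this.trans ?_
      rw [div_div_eq_mul_div, div_one, mul_comm]
      exact mul_le_mul_of_nonneg_right (le_add_of_nonneg_right (by positivity)) (by positivity)
    · have hκ1 : 1 / (K ^ 2 * D) ≤ 1 := by
        rw [div_le_one (by positivity)]
        exact one_le_mul_of_one_le_of_one_le (one_le_pow₀ hK) hD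
      have hmin : ∀ s v v' : ℝ, 1 / D / n ≤ s → 1 / K ≤ v → 1 / K ≤ v' →
          1 / (K ^ 2 * D) / Fintype.card (Fin n) ≤ v * (s * v') := fun s v v' hs hv hv' => by
        rw [Fintype.card_fin]
        calc 1 / (K ^ 2 * D) / n = 1 / K * (1 / D / n * (1 / K)) := by field_simp
          _ ≤ v * (s * v') := by
            have : 0 ≤ s := le_trans (by positivity) hs
            have : 0 ≤ v := le_trans (by positivity) hv
            gcongr
      have hpA : ∀ i j, 1 / (K ^ 2 * D) / Fintype.card (Fin n) ≤ p i * A i j := fun i j => by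
        convert hmin _ _ _ (hS i j) (halt i).1 (halt j).2 using 1
        have ha := (h.a_pos i).ne'
        simp only [hp, hA, Matrix.of_apply, h.v₁_eq i]
        field_simp
      have hpB : ∀ i j, 1 / (K ^ 2 * D) / Fintype.card (Fin n) ≤ p i * B i j := fun i j => by
        convert hmin _ _ _ (hS j i) (halt i).2 (halt j).1 using 1
        have hb := (h.b_pos i).ne'
        simp only [hp, hB, Matrix.of_apply, h.v₂_eq i]
        field_simp
      have hzero : ∑ k, Sum.elim v₁ v₂ k * Sum.elim x z k = 0 := by
        rw [Fintype.sum_sum_type]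
        simp only [Sum.elim_inl, Sum.elim_inr, hx, hz]
        rw [Finset.sum_congr rfl fun i _ => mul_div_cancel₀ (h₁ i) (v₁_pos i).ne', hsum,
          ← Finset.sum_add_distrib]
        refine Finset.sum_eq_zero fun i _ => ?_
        have := (v₂_pos i).ne'
        field_simp
        ring
      have hv : ∀ k, 0 < Sum.elim v₁ v₂ k := by
        rintro (j | j)
        exacts [v₁_pos j, v₂_pos j]
      have hneg : ∃ k, Sum.elim x z k ≤ 0 := by
        by_contra! hpos
        exact (Finset.sum_pos (fun l _ => mul_pos (hv l) (hpos l)) ⟨k, Finset.mem_univ k⟩).ne'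
          hzero
      have hpos : ∃ k, 0 ≤ Sum.elim x z k := by
        by_contra! hneg
        exact (Finset.sum_neg (fun l _ => mul_neg_of_pos_of_neg (hv l) (hneg l))
          ⟨k, Finset.mem_univ k⟩).ne hzero
      have hrow : ∀ c : ℝ, 0 < c → 1 - η / c ≤ 1 := fun c hc => by
        linarith [div_pos hη hc]
      have := abs_le_of_minorization (one_div_pos.mpr (by positivity)) hκ1 hA0 hB0
        (fun i => (hArow i).trans_le (hrow _ (h.a_pos i)))
        (fun i => (hBrow i).trans_le (hrow _ (h.b_pos i))) hp0 hp1 hpA hpB hx' hz' hneg hpos k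
      refine this.trans ?_
      calc 4 * (R / w) / (1 / (K ^ 2 * D)) ^ 2 = 4 * (K ^ 2 * D) ^ 2 * (R / w) := by
            field_simp
        _ ≤ _ := mul_le_mul_of_nonneg_right (le_add_of_nonneg_left hK0.le) (by positivity)
  have final : ∀ s v : ℝ, 0 < v → v ≤ K * w → |s / v| ≤ (K + 4 * (K ^ 2 * D) ^ 2) * (R / w) →
      |s| ≤ K * (K + 4 * (K ^ 2 * D) ^ 2) * R := fun s v hv hvw hs => by
    rw [abs_div, abs_of_pos hv, div_le_iff₀ hv] at hs
    refine hs.trans ?_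
    calc (K + 4 * (K ^ 2 * D) ^ 2) * (R / w) * v
        ≤ (K + 4 * (K ^ 2 * D) ^ 2) * (R / w) * (K * w) :=
          mul_le_mul_of_nonneg_left hvw (by positivity)
      _ = _ := by field_simp
  refine ⟨final _ _ (v₁_pos i) (hb.v₁_le_mul i) (hbound (Sum.inl i)),
    final _ _ (v₂_pos i) (hb.v₂_le_mul i) ?_⟩
  have := hbound (Sum.inr i)
  simpa only [hz, Sum.elim_inr, abs_neg] using this

theorem re_map_ofReal_mulVec {n : ℕ} (M : Matrix (Fin n) (Fin n) ℝ) (y : Fin n → ℂ) (i : Fin n) :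
    ((M.map Complex.ofReal *ᵥ y) i).re = (M *ᵥ fun j => (y j).re) i := by
  simp [Matrix.mulVec, dotProduct]

theorem im_map_ofReal_mulVec {n : ℕ} (M : Matrix (Fin n) (Fin n) ℝ) (y : Fin n → ℂ) (i : Fin n) :
    ((M.map Complex.ofReal *ᵥ y) i).im = (M *ᵥ fun j => (y j).im) i := by
  simp [Matrix.mulVec, dotProduct]

theorem DysonCoeffs.complex_linear_stability {n : ℕ} {S : Matrix (Fin n) (Fin n) ℝ}
    {D K τ η w R : ℝ} {v₁ v₂ a b u : Fin n → ℝ} {h₁ h₂ : Fin n → ℂ}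
    (h : DysonCoeffs S τ η v₁ v₂ a b u)
    (hb : DysonBounds η v₁ v₂ a b u w K) (hK : 1 ≤ K) (hD : 1 ≤ D)
    (hS : ∀ i j, 1 / D / n ≤ S i j) (hτ : 0 ≤ τ) (hη : 0 < η)
    (h1 : ∀ i, ‖h₁ i + (v₁ i : ℂ) ^ 2 * (S.map Complex.ofReal *ᵥ h₂) i
      - τ * (u i : ℂ) ^ 2 * (Sᵀ.map Complex.ofReal *ᵥ h₁) i‖ ≤ R)
    (h2 : ∀ i, ‖h₂ i + (v₂ i : ℂ) ^ 2 * (Sᵀ.map Complex.ofReal *ᵥ h₁) i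
      - τ * (u i : ℂ) ^ 2 * (S.map Complex.ofReal *ᵥ h₂) i‖ ≤ R)
    (hsum : ∑ i, h₁ i = ∑ i, h₂ i) (i : Fin n) :
    ‖h₁ i‖ ≤ 2 * (K * (K + 4 * (K ^ 2 * D) ^ 2)) * R ∧
      ‖h₂ i‖ ≤ 2 * (K * (K + 4 * (K ^ 2 * D) ^ 2)) * R := by
  have hre := h.linear_stability (R := R) hb hK hD hS hτ hη (h₁ := fun j => (h₁ j).re)
    (h₂ := fun j => (h₂ j).re)
    (fun j => by
      refine le_trans (le_of_eq ?_) ((Complex.abs_re_le_norm _).trans (h1 j))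
      simp only [← Complex.ofReal_pow, ← Complex.ofReal_mul, Complex.sub_re, Complex.add_re,
        Complex.re_ofReal_mul, re_map_ofReal_mulVec])
    (fun j => by
      refine le_trans (le_of_eq ?_) ((Complex.abs_re_le_norm _).trans (h2 j))
      simp only [← Complex.ofReal_pow, ← Complex.ofReal_mul, Complex.sub_re, Complex.add_re,
        Complex.re_ofReal_mul, re_map_ofReal_mulVec])
    (by rw [← Complex.re_sum, hsum, Complex.re_sum]) i
  have him := h.linear_stability (R := R) hb hK hD hS hτ hη (h₁ := fun j => (h₁ j).im)
    (h₂ := fun j => (h₂ j).im)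
    (fun j => by
      refine le_trans (le_of_eq ?_) ((Complex.abs_im_le_norm _).trans (h1 j))
      simp only [← Complex.ofReal_pow, ← Complex.ofReal_mul, Complex.sub_im, Complex.add_im,
        Complex.im_ofReal_mul, im_map_ofReal_mulVec])
    (fun j => by
      refine le_trans (le_of_eq ?_) ((Complex.abs_im_le_norm _).trans (h2 j))
      simp only [← Complex.ofReal_pow, ← Complex.ofReal_mul, Complex.sub_im, Complex.add_im,
        Complex.im_ofReal_mul, im_map_ofReal_mulVec])
    (by rw [← Complex.im_sum, hsum, Complex.im_sum]) i
  exact ⟨(Complex.norm_le_abs_re_add_abs_im _).trans (by linarith [hre.1, him.1]),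
    (Complex.norm_le_abs_re_add_abs_im _).trans (by linarith [hre.2, him.2])⟩

/-- Expansion of the perturbed Dyson equation around the solution `i v`. -/
theorem perturbed_dyson_expansion {τ v a b u : ℝ} {h d s t : ℂ} (hv : v = u * b)
    (hu : u * (a * b + τ) = 1) (hB : Complex.I * b + t ≠ 0)
    (hAB : Complex.I * a + s - τ / (Complex.I * b + t) ≠ 0)
    (heq : Complex.I * v + h + (Complex.I * a + s - τ / (Complex.I * b + t))⁻¹ = d) :
    h + (v : ℂ) ^ 2 * s - τ * (u : ℂ) ^ 2 * t =
      d + Complex.I * (v * u : ℝ) * (s * t)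
        + (h - d) * (Complex.I * ((u * a : ℝ) * t + (u * b : ℝ) * s) + u * (s * t)) := by
  have huC : (u : ℂ) * (a * b + τ) = 1 := by exact_mod_cast hu
  have hE : (d - Complex.I * v - h) * ((Complex.I * a + s) * (Complex.I * b + t) - τ)
      = Complex.I * b + t := by
    have h1 : (d - Complex.I * v - h) * (Complex.I * a + s - τ / (Complex.I * b + t)) = 1 := by
      rw [← heq, add_sub_right_comm, add_sub_right_comm, sub_sub, sub_self, zero_add,
        inv_mul_cancel₀ hAB]
    have h2 : (Complex.I * a + s - τ / (Complex.I * b + t)) * (Complex.I * b + t)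
        = (Complex.I * a + s) * (Complex.I * b + t) - τ := by
      rw [sub_mul, div_mul_cancel₀ _ hB]
    rw [← h2, ← mul_assoc, h1, one_mul]
  subst hv
  push_cast at hE ⊢
  linear_combination (u : ℂ) * hE
    + (-(u : ℂ) * t + d - Complex.I * u * b - h) * huC
    - ((u : ℂ) * (d - Complex.I * u * b - h) * a * b - (u : ℂ) ^ 2 * b * (a * t + b * s))
      * Complex.I_sq

theorem norm_expansion_remainder_le {K D H δ c₁ c₂ c₃ : ℝ} {u : ℝ} {h d s t : ℂ} (hK : 1 ≤ K)
    (hD : 1 ≤ D) (hH1 : H ≤ 1) (hh : ‖h‖ ≤ H) (hd : ‖d‖ ≤ δ) (hs : ‖s‖ ≤ D * H) (ht : ‖t‖ ≤ D * H)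
    (hc₁ : |c₁| ≤ K ^ 2) (hc₂ : |c₂| ≤ K) (hc₃ : |c₃| ≤ K) (hu : |u| ≤ K) :
    ‖d + Complex.I * c₁ * (s * t) + (h - d) * (Complex.I * (c₂ * t + c₃ * s) + u * (s * t))‖ ≤
      4 * K ^ 2 * D ^ 2 * (δ + H ^ 2) := by
  have hH : 0 ≤ H := (norm_nonneg _).trans hh
  have hδ : 0 ≤ δ := (norm_nonneg _).trans hd
  have hst : ‖s * t‖ ≤ D ^ 2 * H ^ 2 := by
    rw [norm_mul]
    calc ‖s‖ * ‖t‖ ≤ (D * H) * (D * H) := mul_le_mul hs ht (norm_nonneg _) (by positivity)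
      _ = _ := by ring
  have hmul : ∀ (c C M : ℝ) (y : ℂ), |c| ≤ C → ‖y‖ ≤ M → ‖(c : ℂ) * y‖ ≤ C * M :=
    fun c C M y hc hy => by
      rw [norm_mul, Complex.norm_real, Real.norm_eq_abs]
      exact mul_le_mul hc hy (norm_nonneg _) ((abs_nonneg _).trans hc)
  have e1 : ‖Complex.I * c₁ * (s * t)‖ ≤ K ^ 2 * (D ^ 2 * H ^ 2) := by
    rw [mul_assoc, norm_mul, Complex.norm_I, one_mul]
    exact hmul _ _ _ _ hc₁ hst
  have e2 : ‖Complex.I * (c₂ * t + c₃ * s) + u * (s * t)‖ ≤ 3 * K ^ 2 * D ^ 2 * H := by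
    calc _ ≤ ‖Complex.I * (c₂ * t + c₃ * s)‖ + ‖u * (s * t)‖ := norm_add_le _ _
      _ ≤ (K * (D * H) + K * (D * H)) + K * (D ^ 2 * H ^ 2) := by
          refine add_le_add ?_ (hmul _ _ _ _ hu hst)
          rw [norm_mul, Complex.norm_I, one_mul]
          exact (norm_add_le _ _).trans (add_le_add (hmul _ _ _ _ hc₂ ht) (hmul _ _ _ _ hc₃ hs))
      _ ≤ (K * (D ^ 2 * H) + K * (D ^ 2 * H)) + K * (D ^ 2 * H) := by
          have hDD : D ≤ D ^ 2 := le_self_pow₀ hD (by norm_num)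
          have hHH : H ^ 2 ≤ H := by nlinarith
          gcongr
      _ = 3 * K * (D ^ 2 * H) := by ring
      _ ≤ 3 * K ^ 2 * (D ^ 2 * H) := by
          have hKK : K ≤ K ^ 2 := le_self_pow₀ hK (by norm_num)
          gcongr
      _ = _ := by ring
  have e3 : ‖(h - d) * (Complex.I * (c₂ * t + c₃ * s) + u * (s * t))‖ ≤
      (H + δ) * (3 * K ^ 2 * D ^ 2 * H) := by
    rw [norm_mul]
    exact mul_le_mul ((norm_sub_le _ _).trans (add_le_add hh hd)) e2 (norm_nonneg _) (by positivity)
  have hKD : 1 ≤ K ^ 2 * D ^ 2 :=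
    one_le_mul_of_one_le_of_one_le (one_le_pow₀ hK) (one_le_pow₀ hD)
  calc _ ≤ δ + K ^ 2 * (D ^ 2 * H ^ 2) + (H + δ) * (3 * K ^ 2 * D ^ 2 * H) :=
        (norm_add_le _ _).trans (add_le_add ((norm_add_le _ _).trans (add_le_add hd e1)) e3)
    _ = 4 * (K ^ 2 * D ^ 2) * H ^ 2 + δ * (1 + 3 * (K ^ 2 * D ^ 2) * H) := by ring
    _ ≤ 4 * (K ^ 2 * D ^ 2) * H ^ 2 + δ * (K ^ 2 * D ^ 2 + 3 * (K ^ 2 * D ^ 2) * 1) := by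
        gcongr
    _ = _ := by ring

theorem norm_map_ofReal_mulVec_le {n : ℕ} (hn : 1 ≤ n) {M : Matrix (Fin n) (Fin n) ℝ} {D H : ℝ}
    (hM0 : ∀ i j, 0 ≤ M i j) (hM : ∀ i j, M i j ≤ D / n) {y : Fin n → ℂ} (hy : ∀ j, ‖y j‖ ≤ H)
    (i : Fin n) : ‖(M.map Complex.ofReal *ᵥ y) i‖ ≤ D * H := by
  have hn0 : (0 : ℝ) < n := by exact_mod_cast hn
  calc ‖(M.map Complex.ofReal *ᵥ y) i‖ ≤ ∑ j, ‖(M i j : ℂ) * y j‖ :=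
        norm_sum_le Finset.univ fun j => (M i j : ℂ) * y j
    _ ≤ ∑ _j : Fin n, D / n * H := by
        refine Finset.sum_le_sum fun j _ => ?_
        rw [norm_mul, Complex.norm_real, Real.norm_of_nonneg (hM0 i j)]
        exact mul_le_mul (hM i j) (hy j) (norm_nonneg _) ((hM0 i j).trans (hM i j))
    _ = D * H := by
        rw [Finset.sum_const, Finset.card_univ, Fintype.card_fin, nsmul_eq_mul]
        field_simp

/-- The denominators in the Dyson equation do not vanish on the upper half-plane. -/
theorem ne_zero_and_sub_div_ne_zero_of_im_pos {A B : ℂ} {τ : ℝ} (hτ : 0 ≤ τ) (hA : 0 < A.im)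
    (hB : 0 < B.im) : B ≠ 0 ∧ A - τ / B ≠ 0 := by
  refine ⟨fun h => by simp [h] at hB, fun h => ?_⟩
  have him := congrArg Complex.im h
  rw [Complex.sub_im, div_eq_mul_inv, Complex.im_ofReal_mul, Complex.inv_im, Complex.zero_im] at him
  have : τ * (-B.im / Complex.normSq B) ≤ 0 :=
    mul_nonpos_of_nonneg_of_nonpos hτ
      (div_nonpos_of_nonpos_of_nonneg (by linarith) (Complex.normSq_nonneg B))
  linarith

theorem map_ofReal_mulVec_I_mul_add {n : ℕ} (M : Matrix (Fin n) (Fin n) ℝ) (v : Fin n → ℝ)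
    (h : Fin n → ℂ) (i : Fin n) :
    (M.map Complex.ofReal *ᵥ fun j => Complex.I * v j + h j) i =
      Complex.I * (M *ᵥ v) i + (M.map Complex.ofReal *ᵥ h) i := by
  simp only [Matrix.mulVec, dotProduct, Matrix.map_apply, Complex.ofReal_sum, Complex.ofReal_mul,
    mul_add, Finset.sum_add_distrib, Finset.mul_sum]
  congr 1
  exact Finset.sum_congr rfl fun j _ => by ring

theorem im_I_mul_add_mulVec_pos {n : ℕ} {M : Matrix (Fin n) (Fin n) ℝ} {η : ℝ} {g : Fin n → ℂ}
    (hM : ∀ i j, 0 ≤ M i j) (hη : 0 < η) (hg : ∀ j, 0 < (g j).im) (i : Fin n) :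
    0 < (Complex.I * η + (M.map Complex.ofReal *ᵥ g) i).im := by
  rw [Complex.add_im, im_map_ofReal_mulVec]
  simp only [Complex.mul_im, Complex.I_re, Complex.I_im, Complex.ofReal_re, Complex.ofReal_im,
    mul_zero, zero_add, one_mul]
  exact add_pos_of_pos_of_nonneg hη
    (Finset.sum_nonneg (s := Finset.univ) fun j _ => mul_nonneg (hM i j) (hg j).le)

/-- Quadratic bound: the deviation `h` of a solution of the perturbed Dyson equation from `i v` is
controlled by `δ + ‖h‖²` if the perturbation is at most `δ`. -/
theorem DysonCoeffs.quadratic_stability {n : ℕ} {S : Matrix (Fin n) (Fin n) ℝ}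
    {D K τ η w H δ : ℝ} {v₁ v₂ a b u : Fin n → ℝ} {h₁ h₂ d₁ d₂ : Fin n → ℂ}
    (h : DysonCoeffs S τ η v₁ v₂ a b u) (hb : DysonBounds η v₁ v₂ a b u w K)
    (hn : 1 ≤ n) (hK : 1 ≤ K) (hD : 1 ≤ D)
    (hS : ∀ i j, 1 / D / n ≤ S i j ∧ S i j ≤ D / n) (hτ : 0 ≤ τ) (hη : 0 < η)
    (hg₁ : ∀ i, 0 < (Complex.I * v₁ i + h₁ i).im) (hg₂ : ∀ i, 0 < (Complex.I * v₂ i + h₂ i).im)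
    (heq₁ : ∀ i, Complex.I * v₁ i + h₁ i +
      (Complex.I * η + (S.map Complex.ofReal *ᵥ fun j => Complex.I * v₂ j + h₂ j) i -
        τ / (Complex.I * η +
          (Sᵀ.map Complex.ofReal *ᵥ fun j => Complex.I * v₁ j + h₁ j) i))⁻¹ = d₁ i)
    (heq₂ : ∀ i, Complex.I * v₂ i + h₂ i +
      (Complex.I * η + (Sᵀ.map Complex.ofReal *ᵥ fun j => Complex.I * v₁ j + h₁ j) i -
        τ / (Complex.I * η +
          (S.map Complex.ofReal *ᵥ fun j => Complex.I * v₂ j + h₂ j) i))⁻¹ = d₂ i)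
    (hsum : ∑ i, (Complex.I * v₁ i + h₁ i) = ∑ i, (Complex.I * v₂ i + h₂ i))
    (hH1 : H ≤ 1) (hh₁ : ∀ i, ‖h₁ i‖ ≤ H) (hh₂ : ∀ i, ‖h₂ i‖ ≤ H)
    (hd₁ : ∀ i, ‖d₁ i‖ ≤ δ) (hd₂ : ∀ i, ‖d₂ i‖ ≤ δ) (i : Fin n) :
    ‖h₁ i‖ ≤ 2 * (K * (K + 4 * (K ^ 2 * D) ^ 2)) * (4 * K ^ 2 * D ^ 2 * (δ + H ^ 2)) ∧
      ‖h₂ i‖ ≤ 2 * (K * (K + 4 * (K ^ 2 * D) ^ 2)) * (4 * K ^ 2 * D ^ 2 * (δ + H ^ 2)) := by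
  have hD0 : 0 < D := by linarith
  have hS0 : ∀ i j, 0 ≤ S i j := fun i j => le_trans (by positivity) (hS i j).1
  have hST0 : ∀ i j, 0 ≤ Sᵀ i j := fun i j => hS0 j i
  have hs := norm_map_ofReal_mulVec_le hn hS0 (fun i j => (hS i j).2) hh₂
  have ht := norm_map_ofReal_mulVec_le hn hST0 (fun i j => (hS j i).2) hh₁
  have hA : ∀ i, Complex.I * η + (S.map Complex.ofReal *ᵥ fun j => Complex.I * v₂ j + h₂ j) i =
      Complex.I * a i + (S.map Complex.ofReal *ᵥ h₂) i := fun i => by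
    rw [map_ofReal_mulVec_I_mul_add, h.a_eq]; push_cast; ring
  have hB : ∀ i, Complex.I * η + (Sᵀ.map Complex.ofReal *ᵥ fun j => Complex.I * v₁ j + h₁ j) i =
      Complex.I * b i + (Sᵀ.map Complex.ofReal *ᵥ h₁) i := fun i => by
    rw [map_ofReal_mulVec_I_mul_add, h.b_eq]; push_cast; ring
  have hAim : ∀ i, 0 < (Complex.I * a i + (S.map Complex.ofReal *ᵥ h₂) i).im := fun i => by
    rw [← hA]; exact im_I_mul_add_mulVec_pos hS0 hη hg₂ i
  have hBim : ∀ i, 0 < (Complex.I * b i + (Sᵀ.map Complex.ofReal *ᵥ h₁) i).im := fun i => by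
    rw [← hB]; exact im_I_mul_add_mulVec_pos hST0 hη hg₁ i
  have v₁_abs : ∀ i, |v₁ i| ≤ K := fun i => by
    rw [abs_of_pos (hb.w_pos.trans_le (hb.le_v₁ i))]; exact hb.v₁_le i
  have v₂_abs : ∀ i, |v₂ i| ≤ K := fun i => by
    rw [abs_of_pos (hb.w_pos.trans_le (hb.le_v₂ i))]; exact hb.v₂_le i
  have u_abs : ∀ i, |u i| ≤ K := fun i => by
    rw [abs_of_pos (h.u_pos i)]; exact hb.u_le i
  have mul_abs_le : ∀ x y : ℝ, |x| ≤ K → |y| ≤ K → |x * y| ≤ K ^ 2 := fun x y hx hy => by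
    rw [abs_mul, sq]; exact mul_le_mul hx hy (abs_nonneg _) (by linarith)
  refine h.complex_linear_stability hb hK hD (fun i j => (hS i j).1) hτ hη (fun i => ?_)
    (fun i => ?_) ?_ i
  · have hne := ne_zero_and_sub_div_ne_zero_of_im_pos hτ (hAim i) (hBim i)
    rw [perturbed_dyson_expansion (d := d₁ i) (h.v₁_eq i) (h.u_eq i) hne.1 hne.2
      (by rw [← hA, ← hB]; exact heq₁ i)]
    exact norm_expansion_remainder_le hK hD hH1 (hh₁ i) (hd₁ i) (hs i) (ht i)
      (mul_abs_le _ _ (v₁_abs i) (u_abs i)) (by rw [← h.v₂_eq]; exact v₂_abs i)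
      (by rw [← h.v₁_eq]; exact v₁_abs i) (u_abs i)
  · have hne := ne_zero_and_sub_div_ne_zero_of_im_pos hτ (hBim i) (hAim i)
    rw [perturbed_dyson_expansion (d := d₂ i) (h.v₂_eq i)
      (by rw [mul_comm (b i)]; exact h.u_eq i) hne.1 hne.2
      (by rw [← hA, ← hB]; exact heq₂ i)]
    exact norm_expansion_remainder_le hK hD hH1 (hh₂ i) (hd₂ i) (ht i) (hs i)
      (mul_abs_le _ _ (v₂_abs i) (u_abs i)) (by rw [← h.v₁_eq]; exact v₁_abs i)
      (by rw [← h.v₂_eq]; exact v₂_abs i) (u_abs i)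
  · rw [Finset.sum_add_distrib, Finset.sum_add_distrib, ← Finset.mul_sum, ← Finset.mul_sum,
      ← Complex.ofReal_sum, ← Complex.ofReal_sum, h.sum_eq] at hsum
    exact add_left_cancel hsum

/-- **Stability of the Dyson equation:** if `g` solves the perturbed Dyson
equation with perturbation `d`, takes values in the upper half-plane, and
satisfies `⟨g₁⟩ = ⟨g₂⟩`, then there are constants `λ⁎, C > 0`, depending only
on `s⁎, s⁺, τ⁎, τ⁺`, such that whenever `‖g(η) − i v(η)‖_∞ ≤ λ⁎` one has
`‖g(η) − i v(η)‖_∞ ≤ C ‖d(η)‖_∞`, uniformly for `η > 0` and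
`τ ∈ [0, 1−τ⁎] ∪ [1+τ⁎, τ⁺]`. -/
theorem dyson_equation_stability
    (sl su τs τsup : ℝ) (hsl : 0 < sl) (hslsu : sl ≤ su)
    (hτs : 0 < τs) (hτs1 : τs < 1) (hτsup : 1 + τs < τsup) :
    ∃ lam > (0:ℝ), ∃ C > (0:ℝ),
      ∀ (n : ℕ), 1 ≤ n → ∀ S : Matrix (Fin n) (Fin n) ℝ,
        (∀ i j, sl / n ≤ S i j ∧ S i j ≤ su / n) → specRad S = 1 →
        ∀ v₁ v₂ : ℝ → ℝ → (Fin n → ℝ),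
          (∀ τ : ℝ, 0 ≤ τ → ∀ η : ℝ, 0 < η →
            IsDysonSolution S τ η (v₁ τ η) (v₂ τ η)) →
        ∀ τ : ℝ, τ ∈ Set.Icc (0:ℝ) (1 - τs) ∪ Set.Icc (1 + τs) τsup →
        ∀ g d : ℝ → (Fin n ⊕ Fin n → ℂ),
          (∀ η : ℝ, 0 < η → ∀ k, 0 < (g η k).im) →
          PerturbedDysonEq S τ g d →
          (∀ η : ℝ, 0 < η →
            (∑ i, g η (Sum.inl i)) = ∑ i, g η (Sum.inr i)) →
        ∀ η : ℝ, 0 < η →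
          ‖(fun k => g η k -
              Complex.I * ((Sum.elim (v₁ τ η) (v₂ τ η) k : ℝ) : ℂ))‖ ≤ lam →
          ‖(fun k => g η k -
              Complex.I * ((Sum.elim (v₁ τ η) (v₂ τ η) k : ℝ) : ℂ))‖ ≤
            C * ‖d η‖ := by
  obtain ⟨D, hDdef⟩ : ∃ D, D = 1 / sl + su + 1 / τs + 1 := ⟨_, rfl⟩
  have hsu : 0 < su := hsl.trans_le hslsu
  have hsl' := one_div_pos.mpr hsl
  have hτs' := one_div_pos.mpr hτs
  have hD : 1 ≤ D := by linarith
  have hD0 : 0 < D := by linarith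
  have hDsl : 1 / D ≤ sl := by
    rw [div_le_iff₀ hD0, ← div_le_iff₀' hsl]; linarith
  have hDτ : 1 / D ≤ τs := by
    rw [div_le_iff₀ hD0, ← div_le_iff₀' hτs]; linarith
  obtain ⟨K, hKdef⟩ : ∃ K, K = 5 * D ^ 13 := ⟨_, rfl⟩
  have hK : 1 ≤ K := by linarith [one_le_pow₀ hD (n := 13)]
  have hK0 : 0 < K := by linarith
  obtain ⟨P, hP⟩ : ∃ P, P = 2 * (K * (K + 4 * (K ^ 2 * D) ^ 2)) * (4 * K ^ 2 * D ^ 2) := ⟨_, rfl⟩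
  have hP0 : 0 < P := by rw [hP]; positivity
  refine ⟨min 1 (1 / (2 * P)), by positivity, 2 * P, by positivity, ?_⟩
  intro n hn S hS hr v₁ v₂ hv τ hτ g d hg hgd hsum η hη hlam
  have hn0 : (0 : ℝ) < n := by exact_mod_cast hn
  have hτ0 : 0 ≤ τ := by
    rcases hτ with hτ | hτ
    · exact hτ.1
    · linarith [hτ.1]
  have hSD : ∀ i j, 1 / D / n ≤ S i j ∧ S i j ≤ D / n := fun i j =>
    ⟨(div_le_div_of_nonneg_right hDsl hn0.le).trans (hS i j).1,
      (hS i j).2.trans (div_le_div_of_nonneg_right (by linarith) hn0.le)⟩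
  have hS0 : ∀ i j, 0 ≤ S i j := fun i j => le_trans (by positivity) (hSD i j).1
  obtain ⟨a, b, u, hc⟩ := (hv τ hτ0 η hη).exists_coeffs hS0 hτ0 hη
  obtain ⟨w, hb⟩ := hc.exists_bounds hn hD hSD hr hτ0 hη
    (hτ.imp (fun h => h.2.trans (by linarith)) (fun h => le_trans (by linarith) h.1))
  rw [← hKdef] at hb
  set h : Fin n ⊕ Fin n → ℂ :=
    fun k => g η k - Complex.I * ((Sum.elim (v₁ τ η) (v₂ τ η) k : ℝ) : ℂ) with hh
  have hg₁ : ∀ i, Complex.I * (v₁ τ η i : ℂ) + h (Sum.inl i) = g η (Sum.inl i) := fun i => by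
    simp [hh]
  have hg₂ : ∀ i, Complex.I * (v₂ τ η i : ℂ) + h (Sum.inr i) = g η (Sum.inr i) := fun i => by
    simp [hh]
  have hSo₁ : ∀ i, ((SoM S).map Complex.ofReal *ᵥ g η) (Sum.inl i) =
      (S.map Complex.ofReal *ᵥ fun j => g η (Sum.inr j)) i := fun i => by
    simp [SoM, Matrix.mulVec, dotProduct]
  have hSo₂ : ∀ i, ((SoM S).map Complex.ofReal *ᵥ g η) (Sum.inr i) =
      (Sᵀ.map Complex.ofReal *ᵥ fun j => g η (Sum.inl j)) i := fun i => by
    simp [SoM, Matrix.mulVec, dotProduct]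
  have hSd₁ : ∀ i, ((SdM S).map Complex.ofReal *ᵥ g η) (Sum.inl i) =
      (Sᵀ.map Complex.ofReal *ᵥ fun j => g η (Sum.inl j)) i := fun i => by
    simp [SdM, Matrix.mulVec, dotProduct]
  have hSd₂ : ∀ i, ((SdM S).map Complex.ofReal *ᵥ g η) (Sum.inr i) =
      (S.map Complex.ofReal *ᵥ fun j => g η (Sum.inr j)) i := fun i => by
    simp [SdM, Matrix.mulVec, dotProduct]
  have hquad := hc.quadratic_stability (H := ‖h‖) (δ := ‖d η‖)
    (h₁ := fun i => h (Sum.inl i)) (h₂ := fun i => h (Sum.inr i))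
    (d₁ := fun i => d η (Sum.inl i)) (d₂ := fun i => d η (Sum.inr i)) hb hn hK hD hSD hτ0 hη
    (fun i => by rw [hg₁]; exact hg η hη _) (fun i => by rw [hg₂]; exact hg η hη _)
    (fun i => by
      have := hgd η hη (Sum.inl i)
      rw [hSo₁, hSd₁] at this
      simpa only [hg₁, hg₂] using this)
    (fun i => by
      have := hgd η hη (Sum.inr i)
      rw [hSo₂, hSd₂] at this
      simpa only [hg₁, hg₂] using this)
    (by simpa only [hg₁, hg₂] using hsum η hη) (hlam.trans (min_le_left _ _))
    (fun i => norm_le_pi_norm h _) (fun i => norm_le_pi_norm h _)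
    (fun i => norm_le_pi_norm (d η) _) (fun i => norm_le_pi_norm (d η) _)
  have hnorm : ‖h‖ ≤ P * (‖d η‖ + ‖h‖ ^ 2) := by
    rw [hP, mul_assoc]
    refine (pi_norm_le_iff_of_nonneg (by positivity)).mpr ?_
    rintro (i | i)
    exacts [(hquad i).1, (hquad i).2]
  have hsmall : P * ‖h‖ ≤ 1 / 2 := by
    calc P * ‖h‖ ≤ P * (1 / (2 * P)) :=
          mul_le_mul_of_nonneg_left (hlam.trans (min_le_right _ _)) hP0.le
      _ = 1 / 2 := by field_simp
  nlinarith [mul_le_mul_of_nonneg_right hsmall (norm_nonneg h)]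
end

section
/- Approximation of the unstable eigenvector: assume ρ(S) = 1 and fix τ_* ∈ (0,1). Define a := e₋·(V v)/‖V v‖₂ ∈ ℝ^{2n}, where V y := √(ṽ/(u_b v))·y. There exists a constant C > 0, depending only on s_*, s^*, τ_*, such that max_i |(f₋)_i − a_i| ≤ Cη uniformly for all η ∈ (0,1] and all τ ∈ [0, 1−τ_*]. -/
open Matrix

/-- The auxiliary vector `u = v₁/(η + Sᵗ v₁)`. -/
noncomputable def uvec {n : ℕ} (S : Matrix (Fin n) (Fin n) ℝ) (η : ℝ)
    (v₁ : Fin n → ℝ) : Fin n → ℝ :=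
  fun i => v₁ i / (η + S.transpose.mulVec v₁ i)

/-- The matrix `F = diag(w) S_o diag(w)` with `w = √(v u/ṽ)`. -/
noncomputable def FM {n : ℕ} (S : Matrix (Fin n) (Fin n) ℝ) (η : ℝ)
    (v₁ v₂ : Fin n → ℝ) : Matrix (Fin n ⊕ Fin n) (Fin n ⊕ Fin n) ℝ :=
  Matrix.diagonal
      (Sum.elim (fun i => Real.sqrt (v₁ i * uvec S η v₁ i / v₂ i))
        (fun i => Real.sqrt (v₂ i * uvec S η v₁ i / v₁ i))) *
    SoM S *
    Matrix.diagonal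
      (Sum.elim (fun i => Real.sqrt (v₁ i * uvec S η v₁ i / v₂ i))
        (fun i => Real.sqrt (v₂ i * uvec S η v₁ i / v₁ i)))

/-- The ℓ² → ℓ² operator norm of a real matrix. -/
noncomputable def opNorm2 {m : Type*} [Fintype m] [DecidableEq m]
    (A : Matrix m m ℝ) : ℝ :=
  ‖LinearMap.toContinuousLinearMap (Matrix.toEuclideanLin A)‖

/-- The normalized ℓ² norm of a real vector. -/
noncomputable def nrm2 {m : Type*} [Fintype m] (x : m → ℝ) : ℝ :=
  Real.sqrt ((∑ i, (x i) ^ 2) / (Fintype.card m))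

/-- The sign vector `e₋ = (1, …, 1, −1, …, −1)`. -/
def eMinus {n : ℕ} : Fin n ⊕ Fin n → ℝ :=
  Sum.elim (fun _ => (1:ℝ)) (fun _ => (-1:ℝ))

/-- The vector `V v`, where `V y = √(ṽ/(u v)) y` and `v = (v₁, v₂)`. -/
noncomputable def Vv {n : ℕ} (S : Matrix (Fin n) (Fin n) ℝ) (η : ℝ)
    (v₁ v₂ : Fin n → ℝ) : Fin n ⊕ Fin n → ℝ :=
  Sum.elim (fun i => Real.sqrt (v₂ i / (uvec S η v₁ i * v₁ i)) * v₁ i)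
    (fun i => Real.sqrt (v₁ i / (uvec S η v₁ i * v₂ i)) * v₂ i)

section Auxiliary

open Finset

section NormalizedNorm

variable {m : Type*} [Fintype m]

lemma nrm2_one [Nonempty m] : nrm2 (fun _ : m => (1 : ℝ)) = 1 := by
  simp [nrm2]

lemma nrm2_le_mul {f g : m → ℝ} {q : ℝ} (hq : 0 ≤ q) (hg : ∀ k, 0 ≤ g k)
    (h : ∀ k, g k ≤ q * f k) : nrm2 g ≤ q * nrm2 f := by
  have hsq : q * nrm2 f = √((∑ k, (q * f k) ^ 2) / Fintype.card m) := by
    simp only [mul_pow, ← mul_sum, mul_div_assoc]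
    rw [Real.sqrt_mul (sq_nonneg q), Real.sqrt_sq hq, nrm2]
  rw [hsq, nrm2]
  gcongr with k
  · exact hg k
  · exact h k

lemma mul_le_nrm2 {f g : m → ℝ} {p : ℝ} (hp : 0 < p) (hf : ∀ k, 0 ≤ f k)
    (h : ∀ k, p * f k ≤ g k) : p * nrm2 f ≤ nrm2 g := by
  have := nrm2_le_mul (f := g) (inv_nonneg.2 hp.le) hf fun k => by
    rw [inv_mul_eq_div, le_div_iff₀ hp, mul_comm]
    exact h k
  rwa [inv_mul_eq_div, le_div_iff₀ hp, mul_comm] at this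

end NormalizedNorm

section Averages

variable {n : ℕ}

lemma sum_div_natCast (hn : 1 ≤ n) (a : ℝ) : ∑ _j : Fin n, a / n = a := by
  have : (n : ℝ) ≠ 0 := by positivity
  simp [mul_div_cancel₀ a this]

lemma mul_le_sum_mul (hn : 1 ≤ n) {c p : ℝ} {M x : Fin n → ℝ} (hc : 0 ≤ c)
    (hM : ∀ j, c / n ≤ M j) (hp : ∀ j, p ≤ x j) (hp0 : 0 ≤ p) :
    c * p ≤ ∑ j, M j * x j := by
  rw [← sum_div_natCast hn (c * p)]
  refine sum_le_sum fun j _ => ?_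
  rw [mul_div_right_comm]
  exact mul_le_mul (hM j) (hp j) hp0 (le_trans (by positivity) (hM j))

lemma sum_mul_le_mul (hn : 1 ≤ n) {d q : ℝ} {M x : Fin n → ℝ} (hd : 0 ≤ d)
    (hM : ∀ j, M j ≤ d / n) (hx : ∀ j, 0 ≤ x j) (hq : ∀ j, x j ≤ q) :
    ∑ j, M j * x j ≤ d * q := by
  rw [← sum_div_natCast hn (d * q)]
  refine sum_le_sum fun j _ => ?_
  rw [mul_div_right_comm]
  exact mul_le_mul (hM j) (hq j) (hx j) (by positivity)

/-- Doeblin's contraction of the oscillation by weights bounded below. -/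
lemma sum_sub_sum_le_of_minorized (hn : 1 ≤ n) {δ lo hi : ℝ} {p q x : Fin n → ℝ}
    (hp : ∀ j, δ / n ≤ p j) (hq : ∀ j, δ / n ≤ q j)
    (hp1 : ∑ j, p j = 1) (hq1 : ∑ j, q j = 1) (hlo : ∀ j, lo ≤ x j) (hhi : ∀ j, x j ≤ hi) :
    ∑ j, p j * x j - ∑ j, q j * x j ≤ (1 - δ) * (hi - lo) := by
  have h1 : 0 ≤ ∑ j, (p j - δ / n) * (hi - x j) :=
    sum_nonneg fun j _ => mul_nonneg (sub_nonneg.2 (hp j)) (sub_nonneg.2 (hhi j))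
  have h2 : 0 ≤ ∑ j, (q j - δ / n) * (x j - lo) :=
    sum_nonneg fun j _ => mul_nonneg (sub_nonneg.2 (hq j)) (sub_nonneg.2 (hlo j))
  have hδ := sum_div_natCast hn δ
  have e1 : ∑ j, (p j - δ / n) * (hi - x j) =
      (1 - δ) * hi - ∑ j, p j * x j + ∑ j, δ / n * x j := by
    simp only [sub_mul, mul_sub, sum_sub_distrib, ← sum_mul]
    rw [hp1, hδ]; ring
  have e2 : ∑ j, (q j - δ / n) * (x j - lo) =
      ∑ j, q j * x j - ∑ j, δ / n * x j - (1 - δ) * lo := by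
    simp only [sub_mul, mul_sub, sum_sub_distrib, ← sum_mul]
    rw [hq1, hδ]
  linarith

end Averages

section BipartitePerron

variable {n : ℕ} {c d l : ℝ} {M N : Matrix (Fin n) (Fin n) ℝ} {x y : Fin n → ℝ}

lemma bipartite_eigenvalue_bounds (hn : 1 ≤ n) (hc : 0 < c) (hd : 0 < d)
    (hM : ∀ i j, c / n ≤ M i j ∧ M i j ≤ d / n) (hN : ∀ i j, c / n ≤ N i j ∧ N i j ≤ d / n)
    (hx : ∀ i, 0 < x i) (hy : ∀ i, 0 < y i)
    (hMy : ∀ i, ∑ j, M i j * y j = l * x i) (hNx : ∀ i, ∑ j, N i j * x j = l * y i) :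
    c ≤ l ∧ l ≤ d := by
  have : Nonempty (Fin n) := ⟨⟨0, hn⟩⟩
  constructor
  · obtain ⟨k, hk⟩ := Finite.exists_min (Sum.elim x y)
    rcases k with i | i
    · refine le_of_mul_le_mul_right ?_ (hx i)
      rw [← hMy]
      exact mul_le_sum_mul hn hc.le (fun j => (hM i j).1) (fun j => hk (.inr j)) (hx i).le
    · refine le_of_mul_le_mul_right ?_ (hy i)
      rw [← hNx]
      exact mul_le_sum_mul hn hc.le (fun j => (hN i j).1) (fun j => hk (.inl j)) (hy i).le
  · obtain ⟨k, hk⟩ := Finite.exists_max (Sum.elim x y)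
    rcases k with i | i
    · refine le_of_mul_le_mul_right ?_ (hx i)
      rw [← hMy]
      exact sum_mul_le_mul hn hd.le (fun j => (hM i j).2) (fun j => (hy j).le)
        (fun j => hk (.inr j))
    · refine le_of_mul_le_mul_right ?_ (hy i)
      rw [← hNx]
      exact sum_mul_le_mul hn hd.le (fun j => (hN i j).2) (fun j => (hx j).le)
        (fun j => hk (.inl j))

lemma mul_le_mul_of_sum_eq (hc : 0 < c) (hd : 0 < d) (hl : 0 < l)
    (hM : ∀ i j, c / n ≤ M i j ∧ M i j ≤ d / n) (hy : ∀ i, 0 < y i)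
    (hMy : ∀ i, ∑ j, M i j * y j = l * x i) (i i' : Fin n) : c * x i ≤ d * x i' := by
  refine le_of_mul_le_mul_left ?_ hl
  calc l * (c * x i) = ∑ j, c * (M i j * y j) := by rw [← mul_sum, hMy]; ring
    _ ≤ ∑ j, d * (M i' j * y j) := by
        refine sum_le_sum fun j _ => ?_
        have h : c * M i j ≤ d * M i' j :=
          calc c * M i j ≤ c * (d / n) := by gcongr; exact (hM i j).2
            _ = d * (c / n) := by ring
            _ ≤ d * M i' j := by gcongr; exact (hM i' j).1
        rw [← mul_assoc, ← mul_assoc]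
        exact mul_le_mul_of_nonneg_right h (hy j).le
    _ = l * (d * x i') := by rw [← mul_sum, hMy]; ring

lemma sq_mul_le_sq_mul_of_sum_eq (hn : 1 ≤ n) (hc : 0 < c) (hd : 0 < d) (hl : 0 < l) (hld : l ≤ d)
    (hM : ∀ i j, c / n ≤ M i j ∧ M i j ≤ d / n) (hN : ∀ i j, c / n ≤ N i j ∧ N i j ≤ d / n)
    (hx : ∀ i, 0 < x i) (hy : ∀ i, 0 < y i)
    (hMy : ∀ i, ∑ j, M i j * y j = l * x i) (hNx : ∀ i, ∑ j, N i j * x j = l * y i)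
    (i j : Fin n) : c ^ 2 * y j ≤ d ^ 2 * x i := by
  have h1 : ∀ j', c * y j / d ≤ y j' := fun j' => by
    rw [div_le_iff₀ hd, mul_comm (y j')]
    exact mul_le_mul_of_sum_eq hc hd hl hN hx hNx j j'
  have h2 := mul_le_sum_mul hn hc.le (fun j => (hM i j).1) h1
    (div_nonneg (mul_nonneg hc.le (hy j).le) hd.le)
  rw [hMy, mul_div_assoc', div_le_iff₀ hd] at h2
  have h3 : l * x i * d ≤ d * x i * d :=
    mul_le_mul_of_nonneg_right (mul_le_mul_of_nonneg_right hld (hx i).le) hd.le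
  nlinarith

lemma bipartite_harnack (hn : 1 ≤ n) (hc : 0 < c) (hcd : c ≤ d) (hl : 0 < l) (hld : l ≤ d)
    (hM : ∀ i j, c / n ≤ M i j ∧ M i j ≤ d / n) (hN : ∀ i j, c / n ≤ N i j ∧ N i j ≤ d / n)
    {f : Fin n ⊕ Fin n → ℝ} (hf : ∀ k, 0 < f k)
    (hMf : ∀ i, ∑ j, M i j * f (.inr j) = l * f (.inl i))
    (hNf : ∀ i, ∑ j, N i j * f (.inl j) = l * f (.inr i)) (k k' : Fin n ⊕ Fin n) :
    f k ≤ (d / c) ^ 2 * f k' := by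
  have hd := hc.trans_le hcd
  have hone : 1 ≤ d / c := (one_le_div hc).2 hcd
  have same : ∀ k k', c * f k ≤ d * f k' → f k ≤ (d / c) ^ 2 * f k' := fun k k' h => by
    have h1 : f k ≤ d / c * f k' := by
      rw [div_mul_eq_mul_div, le_div_iff₀ hc, mul_comm]
      exact h
    refine h1.trans (mul_le_mul_of_nonneg_right ?_ (hf k').le)
    nlinarith
  have cross : ∀ k k', c ^ 2 * f k ≤ d ^ 2 * f k' → f k ≤ (d / c) ^ 2 * f k' := fun k k' h => by
    rw [div_pow, div_mul_eq_mul_div, le_div_iff₀ (by positivity), mul_comm]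
    exact h
  rcases k with i | i <;> rcases k' with j | j
  · exact same _ _ (mul_le_mul_of_sum_eq hc hd hl hM (fun i => hf (.inr i)) hMf i j)
  · exact cross _ _ (sq_mul_le_sq_mul_of_sum_eq hn hc hd hl hld hN hM (fun i => hf (.inr i))
      (fun i => hf (.inl i)) hNf hMf j i)
  · exact cross _ _ (sq_mul_le_sq_mul_of_sum_eq hn hc hd hl hld hM hN (fun i => hf (.inl i))
      (fun i => hf (.inr i)) hMf hNf j i)
  · exact same _ _ (mul_le_mul_of_sum_eq hc hd hl hN (fun i => hf (.inl i)) hNf i j)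

/-- The eigenvalue is close to one when a positive vector is almost invariant. -/
lemma bipartite_abs_one_sub_le (hn : 1 ≤ n) {κ K η : ℝ} (hκ : 0 < κ) (hη : 0 < η)
    (hM : ∀ i j, 0 ≤ M i j) (hN : ∀ i j, 0 ≤ N i j)
    {f g w : Fin n ⊕ Fin n → ℝ} (hf : ∀ k, 0 < f k) (hg : ∀ k, κ ≤ g k)
    (hw : ∀ k, 0 ≤ w k ∧ w k ≤ K)
    (hMf : ∀ i, ∑ j, M i j * f (.inr j) = l * f (.inl i))
    (hNf : ∀ i, ∑ j, N i j * f (.inl j) = l * f (.inr i))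
    (hMg : ∀ i, ∑ j, M i j * g (.inr j) = g (.inl i) - η * w (.inl i))
    (hNg : ∀ i, ∑ j, N i j * g (.inl j) = g (.inr i) - η * w (.inr i)) :
    |1 - l| ≤ K / κ * η := by
  have : Nonempty (Fin n) := ⟨⟨0, hn⟩⟩
  have hgf : ∀ k, g k / f k * f k = g k := fun k => div_mul_cancel₀ _ (hf k).ne'
  have hK : 0 ≤ K := (hw (.inl ⟨0, hn⟩)).1.trans (hw _).2
  rw [abs_le]
  constructor
  · obtain ⟨k, hk⟩ := Finite.exists_min (fun k => g k / f k)
    have key : l * g k ≤ g k - η * w k := by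
      have hk' : ∀ k', g k / f k * f k' ≤ g k' := fun k' => by
        rw [← hgf k']; exact mul_le_mul_of_nonneg_right (hk k') (hf k').le
      nth_rw 1 [← hgf k]
      rw [mul_left_comm]
      rcases k with i | i
      · rw [← hMf, ← hMg, mul_sum]
        refine sum_le_sum fun j _ => ?_
        rw [mul_left_comm]
        exact mul_le_mul_of_nonneg_left (hk' _) (hM i j)
      · rw [← hNf, ← hNg, mul_sum]
        refine sum_le_sum fun j _ => ?_
        rw [mul_left_comm]
        exact mul_le_mul_of_nonneg_left (hk' _) (hN i j)
    have h0 : 0 ≤ (1 - l) * g k := by nlinarith [mul_nonneg hη.le (hw k).1]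
    have h1 : 0 ≤ 1 - l := nonneg_of_mul_nonneg_left h0 (hκ.trans_le (hg k))
    have : 0 ≤ K / κ * η := by positivity
    linarith
  · obtain ⟨k, hk⟩ := Finite.exists_max (fun k => g k / f k)
    have key : g k - η * w k ≤ l * g k := by
      have hk' : ∀ k', g k' ≤ g k / f k * f k' := fun k' => by
        rw [← hgf k']; exact mul_le_mul_of_nonneg_right (hk k') (hf k').le
      nth_rw 2 [← hgf k]
      rw [mul_left_comm l]
      rcases k with i | i
      · rw [← hMf, ← hMg, mul_sum]
        refine sum_le_sum fun j _ => ?_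
        rw [mul_left_comm]
        exact mul_le_mul_of_nonneg_left (hk' _) (hM i j)
      · rw [← hNf, ← hNg, mul_sum]
        refine sum_le_sum fun j _ => ?_
        rw [mul_left_comm]
        exact mul_le_mul_of_nonneg_left (hk' _) (hN i j)
    rcases le_or_gt (1 - l) 0 with h | h
    · exact h.trans (by positivity)
    · rw [div_mul_eq_mul_div, le_div_iff₀ hκ]
      calc (1 - l) * κ ≤ (1 - l) * g k := mul_le_mul_of_nonneg_left (hg k) h.le
        _ ≤ η * w k := by linarith
        _ ≤ K * η := by rw [mul_comm]; exact mul_le_mul_of_nonneg_right (hw k).2 hη.le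

/-- One block of the ratio of an almost invariant vector and an eigenvector: it is almost an
average of the other block, with weights bounded below. -/
lemma exists_weights_of_almost_invariant {n : ℕ} {c d l K γ E η : ℝ} {M : Matrix (Fin n) (Fin n) ℝ}
    (hc : 0 < c) (hγ : 0 < γ) (hcl : c ≤ l) (hld : l ≤ d) (hη : 0 < η) (hE : |1 - l| ≤ E * η)
    (hM : ∀ i j, c / n ≤ M i j) {x y p q w : Fin n → ℝ}
    (hx : ∀ i, 0 < x i) (hy : ∀ i, 0 < y i) (hxy : ∀ i j, x i ≤ γ * y j)
    (hx1 : ∀ i, 1 ≤ γ * x i) (hp : ∀ i, 0 ≤ p i ∧ p i ≤ K) (hw : ∀ i, 0 ≤ w i ∧ w i ≤ K)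
    (hMy : ∀ i, ∑ j, M i j * y j = l * x i)
    (hMq : ∀ i, ∑ j, M i j * q j = p i - η * w i) :
    ∃ P : Fin n → Fin n → ℝ, (∀ i j, c / (d * γ) / n ≤ P i j) ∧ (∀ i, ∑ j, P i j = 1) ∧
      ∀ i, |p i / x i - ∑ j, P i j * (q j / y j)| ≤ K * γ * (E + 1) / c * η := by
  have hl := hc.trans_le hcl
  refine ⟨fun i j => M i j * y j / (l * x i), fun i j => ?_, fun i => ?_, fun i => ?_⟩
  · have h0 := hx i
    have hd := hl.trans_le hld
    have : c / (d * γ) / n = c / n * (1 / (d * γ)) := by ring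
    rw [this]
    dsimp only
    rw [mul_div_assoc]
    refine mul_le_mul (hM i j) ?_ (by positivity) (le_trans (by positivity) (hM i j))
    rw [div_le_div_iff₀ (by positivity) (by positivity)]
    calc 1 * (l * x i) ≤ d * (γ * y j) := by rw [one_mul]; gcongr; exact hxy i j
      _ = y j * (d * γ) := by ring
  · rw [← sum_div, hMy, div_self (mul_pos hl (hx i)).ne']
  · have hsum : ∑ j, M i j * y j / (l * x i) * (q j / y j) = (p i - η * w i) / (l * x i) := by
      rw [← hMq, sum_div]
      refine sum_congr rfl fun j _ => ?_
      have := (hy j).ne'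
      field_simp
    rw [hsum]
    have h0 := hx i
    have e : p i / x i - (p i - η * w i) / (l * x i) =
        (η * w i - (1 - l) * p i) / (l * x i) := by
      field_simp
      ring
    have hnum : |η * w i - (1 - l) * p i| ≤ K * (E + 1) * η := by
      calc |η * w i - (1 - l) * p i| ≤ |η * w i| + |(1 - l) * p i| := abs_sub _ _
        _ = η * w i + |1 - l| * p i := by
            rw [abs_mul, abs_mul, abs_of_pos hη, abs_of_nonneg (hw i).1, abs_of_nonneg (hp i).1]
        _ ≤ η * K + E * η * K := by
            have h0 := (abs_nonneg _).trans hE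
            exact add_le_add (mul_le_mul_of_nonneg_left (hw i).2 hη.le)
              (mul_le_mul hE (hp i).2 (hp i).1 h0)
        _ = K * (E + 1) * η := by ring
    rw [e, abs_div, abs_of_pos (mul_pos hl h0), div_le_iff₀ (mul_pos hl h0)]
    have hnn := (abs_nonneg _).trans hnum
    calc |η * w i - (1 - l) * p i| ≤ K * (E + 1) * η * 1 := by rwa [mul_one]
      _ ≤ K * (E + 1) * η * (γ * x i * (l / c)) := by
          refine mul_le_mul_of_nonneg_left ?_ hnn
          exact one_le_mul_of_one_le_of_one_le (hx1 i) ((one_le_div hc).2 hcl)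
      _ = K * γ * (E + 1) / c * η * (l * x i) := by ring

lemma oscillation_le_of_weights (hn : 1 ≤ n) {δ e : ℝ} (hδ : 0 < δ) {P Q : Fin n → Fin n → ℝ}
    (hP : ∀ i j, δ / n ≤ P i j) (hQ : ∀ i j, δ / n ≤ Q i j)
    (hP1 : ∀ i, ∑ j, P i j = 1) (hQ1 : ∀ i, ∑ j, Q i j = 1) {r : Fin n ⊕ Fin n → ℝ}
    (hPr : ∀ i, |r (.inl i) - ∑ j, P i j * r (.inr j)| ≤ e)
    (hQr : ∀ i, |r (.inr i) - ∑ j, Q i j * r (.inl j)| ≤ e) (k k' : Fin n ⊕ Fin n) :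
    r k - r k' ≤ (4 / δ + 1) * e := by
  have : Nonempty (Fin n) := ⟨⟨0, hn⟩⟩
  obtain ⟨M₁, hM₁⟩ := Finite.exists_max fun i => r (.inl i)
  obtain ⟨m₁, hm₁⟩ := Finite.exists_min fun i => r (.inl i)
  obtain ⟨M₂, hM₂⟩ := Finite.exists_max fun i => r (.inr i)
  obtain ⟨m₂, hm₂⟩ := Finite.exists_min fun i => r (.inr i)
  have o₁ := sum_sub_sum_le_of_minorized hn (hP M₁) (hP m₁) (hP1 M₁) (hP1 m₁) hm₂ hM₂
  have o₂ := sum_sub_sum_le_of_minorized hn (hQ M₂) (hQ m₂) (hQ1 M₂) (hQ1 m₂) hm₁ hM₁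
  have a₁ := abs_le.1 (hPr M₁)
  have a₂ := abs_le.1 (hPr m₁)
  have b₁ := abs_le.1 (hQr M₂)
  have b₂ := abs_le.1 (hQr m₂)
  have he : 0 ≤ e := (abs_nonneg _).trans (hPr M₁)
  have d₁ := hm₁ M₁
  have d₂ := hm₂ M₂
  have hosc : r (.inl M₁) - r (.inl m₁) + (r (.inr M₂) - r (.inr m₂)) ≤ 4 / δ * e := by
    rw [div_mul_eq_mul_div, le_div_iff₀ hδ]
    nlinarith
  have up : ∀ i, ∑ j, P i j * r (.inr j) ≤ r (.inr M₂) := fun i =>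
    calc ∑ j, P i j * r (.inr j) ≤ ∑ j, P i j * r (.inr M₂) :=
          sum_le_sum fun j _ => mul_le_mul_of_nonneg_left (hM₂ j)
            (le_trans (by positivity) (hP i j))
      _ = r (.inr M₂) := by rw [← sum_mul, hP1, one_mul]
  have lo : ∀ i, r (.inr m₂) ≤ ∑ j, P i j * r (.inr j) := fun i =>
    calc r (.inr m₂) = ∑ j, P i j * r (.inr m₂) := by rw [← sum_mul, hP1, one_mul]
      _ ≤ ∑ j, P i j * r (.inr j) :=
          sum_le_sum fun j _ => mul_le_mul_of_nonneg_left (hm₂ j)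
            (le_trans (by positivity) (hP i j))
  rw [add_mul, one_mul]
  rcases k with i | i <;> rcases k' with j | j
  · have := hM₁ i; have := hm₁ j; linarith
  · have := (abs_le.1 (hPr i)).2; have := up i; have := hm₂ j; linarith
  · have := hM₂ i; have := lo j; have := (abs_le.1 (hPr j)).1; linarith
  · have := hM₂ i; have := hm₂ j; linarith

/-- A positive almost invariant vector of a bipartite matrix with comparable entries is, after
normalization, close to the positive eigenvector. -/
theorem bipartite_eigenvector_approximation {c d κ K : ℝ} (hc : 0 < c) (hcd : c ≤ d) (hκ : 0 < κ)
    (hK : 0 < K) :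
    ∃ C > (0 : ℝ), ∀ (n : ℕ), 1 ≤ n → ∀ M N : Matrix (Fin n) (Fin n) ℝ,
      (∀ i j, c / n ≤ M i j ∧ M i j ≤ d / n) → (∀ i j, c / n ≤ N i j ∧ N i j ≤ d / n) →
      ∀ (l η : ℝ), 0 < η → ∀ f g w : Fin n ⊕ Fin n → ℝ,
      (∀ k, 0 < f k) → nrm2 f = 1 → (∀ k, κ ≤ g k ∧ g k ≤ K) → (∀ k, 0 ≤ w k ∧ w k ≤ K) →
      (∀ i, ∑ j, M i j * f (.inr j) = l * f (.inl i)) →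
      (∀ i, ∑ j, N i j * f (.inl j) = l * f (.inr i)) →
      (∀ i, ∑ j, M i j * g (.inr j) = g (.inl i) - η * w (.inl i)) →
      (∀ i, ∑ j, N i j * g (.inl j) = g (.inr i) - η * w (.inr i)) →
      ∀ k, |f k - g k / nrm2 g| ≤ C * η := by
  have hd := hc.trans_le hcd
  set γ := (d / c) ^ 2
  have hγ : 0 < γ := by positivity
  set δ := c / (d * γ)
  have hδ : 0 < δ := by positivity
  set E := (4 / δ + 1) * (K * γ * (K / κ + 1) / c)
  have hE : 0 < E := by positivity
  refine ⟨γ * E / κ, by positivity, ?_⟩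
  intro n hn M N hM hN l η hη f g w hf hf1 hg hw hMf hNf hMg hNg k
  have : Nonempty (Fin n ⊕ Fin n) := ⟨.inl ⟨0, hn⟩⟩
  have hg0 : ∀ k, 0 < g k := fun k => hκ.trans_le (hg k).1
  obtain ⟨hcl, hld⟩ := bipartite_eigenvalue_bounds hn hc hd hM hN (fun i => hf (.inl i))
    (fun i => hf (.inr i)) hMf hNf
  have hH := bipartite_harnack hn hc hcd (hc.trans_le hcl) hld hM hN hf hMf hNf
  have hflo : ∀ k, 1 ≤ γ * f k := fun k => by
    have := nrm2_le_mul (f := fun _ => (1 : ℝ)) (q := γ * f k)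
      (mul_pos hγ (hf k)).le (fun k => (hf k).le) fun k' => by rw [mul_one]; exact hH k' k
    rwa [hf1, nrm2_one, mul_one] at this
  have hfup : ∀ k, f k ≤ γ := fun k => by
    have := mul_le_nrm2 (f := fun _ => (1 : ℝ)) (g := f) (p := f k / γ)
      (div_pos (hf k) hγ) (fun _ => zero_le_one) fun k' => by
        rw [mul_one, div_le_iff₀ hγ, mul_comm]; exact hH k k'
    rwa [hf1, nrm2_one, mul_one, div_le_one hγ] at this
  have hc0 : ∀ x : ℝ, c / n ≤ x → 0 ≤ x := fun x h => le_trans (by positivity) h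
  have hl1 := bipartite_abs_one_sub_le hn hκ hη (fun i j => hc0 _ (hM i j).1)
    (fun i j => hc0 _ (hN i j).1) hf (fun k => (hg k).1) hw hMf hNf hMg hNg
  obtain ⟨P, hP, hP1, hPr⟩ := exists_weights_of_almost_invariant hc hγ hcl hld hη hl1
    (fun i j => (hM i j).1) (fun i => hf (.inl i)) (fun i => hf (.inr i)) (fun i j => hH _ _)
    (fun i => hflo _) (fun i => ⟨(hg0 (.inl i)).le, (hg _).2⟩) (fun i => hw (.inl i)) hMf hMg
  obtain ⟨Q, hQ, hQ1, hQr⟩ := exists_weights_of_almost_invariant hc hγ hcl hld hη hl1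
    (fun i j => (hN i j).1) (fun i => hf (.inr i)) (fun i => hf (.inl i)) (fun i j => hH _ _)
    (fun i => hflo _) (fun i => ⟨(hg0 (.inr i)).le, (hg _).2⟩) (fun i => hw (.inr i)) hNf hNg
  have hosc : ∀ k k', g k / f k - g k' / f k' ≤ E * η := fun k k' => by
    have := oscillation_le_of_weights hn hδ hP hQ hP1 hQ1 (r := fun k => g k / f k) hPr hQr k k'
    rwa [← mul_assoc] at this
  have hgf : ∀ k, g k / f k * f k = g k := fun k => div_mul_cancel₀ _ (hf k).ne'
  have hlow : κ ≤ nrm2 g := by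
    have := mul_le_nrm2 (f := fun _ => (1 : ℝ)) hκ (fun _ => zero_le_one)
      fun k => (mul_one κ).le.trans (hg k).1
    rwa [nrm2_one, mul_one] at this
  have hpos := hκ.trans_le hlow
  have hnear : |nrm2 g - g k / f k| ≤ E * η := by
    obtain ⟨a, ha⟩ := Finite.exists_min fun k => g k / f k
    obtain ⟨b, hb⟩ := Finite.exists_max fun k => g k / f k
    have h1 := mul_le_nrm2 (f := f) (g := g) (div_pos (hg0 a) (hf a)) (fun k => (hf k).le)
      fun k => by
        rw [← hgf k]; exact mul_le_mul_of_nonneg_right (ha k) (hf k).le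
    have h2 := nrm2_le_mul (f := f) (g := g) (div_pos (hg0 b) (hf b)).le (fun k => (hg0 k).le)
      fun k => by
        rw [← hgf k]; exact mul_le_mul_of_nonneg_right (hb k) (hf k).le
    rw [hf1, mul_one] at h1 h2
    have h3 := hosc k a
    have h4 := hosc b k
    rw [abs_le]
    constructor <;> linarith
  have e : f k - g k / nrm2 g = f k * (nrm2 g - g k / f k) / nrm2 g := by
    rw [mul_sub, mul_comm _ (g k / f k), hgf]
    field_simp
  rw [e, abs_div, abs_mul, abs_of_pos (hf k), abs_of_pos hpos]
  calc f k * |nrm2 g - g k / f k| / nrm2 g ≤ γ * (E * η) / κ := by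
        gcongr
        exact hfup k
    _ = γ * E / κ * η := by ring

end BipartitePerron

section DysonBounds

variable {n : ℕ} {S : Matrix (Fin n) (Fin n) ℝ} {τ η : ℝ} {v₁ v₂ : Fin n → ℝ}

/-- A positive subinvariant vector bounds the spectral radius of a nonnegative matrix. -/
lemma specRad_le_of_mulVec_le {q : ℝ} {v : Fin n → ℝ} (hS : ∀ i j, 0 ≤ S i j) (hq : 0 ≤ q)
    (hv : ∀ i, 0 < v i) (h : ∀ i, S.mulVec v i ≤ q * v i) : specRad S ≤ q := by
  refine ENNReal.toReal_le_of_le_ofReal hq (iSup₂_le fun μ hμ => ?_)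
  rw [← Matrix.spectrum_toLin', ← Module.End.hasEigenvalue_iff_mem_spectrum] at hμ
  obtain ⟨x, hx⟩ := hμ.exists_hasEigenvector
  have hx0 := hx.2
  have hxe := hx.apply_eq_smul
  obtain ⟨k, hk⟩ := Function.ne_iff.1 hx0
  have : Nonempty (Fin n) := ⟨k⟩
  obtain ⟨i, hi⟩ := Finite.exists_max fun i => ‖x i‖ / v i
  have hxi : 0 < ‖x i‖ / v i :=
    (div_pos (norm_pos_iff.2 hk) (hv k)).trans_le (hi k)
  have hmul : ‖μ‖ * ‖x i‖ ≤ q * ‖x i‖ := by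
    calc ‖μ‖ * ‖x i‖ = ‖∑ j, (S i j : ℂ) * x j‖ := by
          rw [← norm_mul, ← smul_eq_mul, ← Pi.smul_apply, ← hxe]
          rfl
      _ ≤ ∑ j, S i j * ‖x j‖ := (norm_sum_le _ _).trans_eq <| sum_congr rfl fun j _ => by
          rw [norm_mul, Complex.norm_real, Real.norm_of_nonneg (hS i j)]
      _ ≤ ∑ j, S i j * (‖x i‖ / v i * v j) := by
          refine sum_le_sum fun j _ => mul_le_mul_of_nonneg_left ?_ (hS i j)
          rw [← div_le_iff₀ (hv j)]
          exact hi j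
      _ = ‖x i‖ / v i * S.mulVec v i := by
          rw [Matrix.mulVec, dotProduct, mul_sum]
          exact sum_congr rfl fun j _ => by ring
      _ ≤ ‖x i‖ / v i * (q * v i) := mul_le_mul_of_nonneg_left (h i) hxi.le
      _ = q * ‖x i‖ := by
          have := (hv i).ne'
          field_simp
  have hpos : 0 < ‖x i‖ := by
    by_contra hneg
    rw [le_antisymm (not_lt.1 hneg) (norm_nonneg _), zero_div] at hxi
    exact lt_irrefl _ hxi
  rw [← enorm_eq_nnnorm, ← ofReal_norm]
  exact ENNReal.ofReal_le_ofReal (le_of_mul_le_mul_right hmul hpos)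

lemma mulVec_nonneg_of_nonneg (hS : ∀ i j, 0 ≤ S i j) {v : Fin n → ℝ} (hv : ∀ i, 0 < v i)
    (i : Fin n) : 0 ≤ S.mulVec v i := by
  rw [Matrix.mulVec, dotProduct]
  exact sum_nonneg fun j _ => mul_nonneg (hS i j) (hv j).le

lemma IsDysonSolution.uvec_spec (h : IsDysonSolution S τ η v₁ v₂) (hS : ∀ i j, 0 ≤ S i j)
    (hη : 0 < η) (hτ : 0 ≤ τ) (i : Fin n) :
    0 < η + S.mulVec v₂ i ∧ 0 < η + S.transpose.mulVec v₁ i ∧ 0 < uvec S η v₁ i ∧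
      v₁ i = uvec S η v₁ i * (η + S.transpose.mulVec v₁ i) ∧
      v₂ i = uvec S η v₁ i * (η + S.mulVec v₂ i) ∧
      uvec S η v₁ i *
        ((η + S.mulVec v₂ i) * (η + S.transpose.mulVec v₁ i) + τ) = 1 := by
  obtain ⟨h1, h2, e1, e2⟩ := h
  have ha : 0 < η + S.mulVec v₂ i := add_pos_of_pos_of_nonneg hη (mulVec_nonneg_of_nonneg hS h2 i)
  have hb : 0 < η + S.transpose.mulVec v₁ i :=
    add_pos_of_pos_of_nonneg hη (mulVec_nonneg_of_nonneg (fun i j => hS j i) h1 i)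
  have e1 := e1 i
  have e2 := e2 i
  have h1 := h1 i
  have h2 := h2 i
  unfold uvec
  set a := η + S.mulVec v₂ i
  set b := η + S.transpose.mulVec v₁ i
  have e1' : v₁ i * (a * b + τ) = b := by
    field_simp at e1
    linarith
  have e2' : v₂ i * (a * b + τ) = a := by
    field_simp at e2
    linarith
  have hab : 0 < a * b + τ := by positivity
  refine ⟨ha, hb, div_pos h1 hb, (div_mul_cancel₀ _ hb.ne').symm, ?_, ?_⟩
  · rw [eq_comm, div_mul_eq_mul_div, div_eq_iff hb.ne']
    refine mul_right_cancel₀ hab.ne' ?_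
    linear_combination a * e1' - b * e2'
  · rw [div_mul_eq_mul_div, e1', div_self hb.ne']

lemma IsDysonSolution.sum_eq (h : IsDysonSolution S τ η v₁ v₂) (hS : ∀ i j, 0 ≤ S i j)
    (hη : 0 < η) (hτ : 0 ≤ τ) : ∑ i, v₁ i = ∑ i, v₂ i := by
  have e : ∑ i, v₁ i * (η + S.mulVec v₂ i) = ∑ i, v₂ i * (η + S.transpose.mulVec v₁ i) := by
    refine sum_congr rfl fun i _ => ?_
    obtain ⟨-, -, -, e1, e2, -⟩ := h.uvec_spec hS hη hτ i
    linear_combination (η + S.mulVec v₂ i) * e1 - (η + S.transpose.mulVec v₁ i) * e2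
  have ex : ∑ i, v₁ i * S.mulVec v₂ i = ∑ i, v₂ i * S.transpose.mulVec v₁ i := by
    change v₁ ⬝ᵥ S.mulVec v₂ = v₂ ⬝ᵥ S.transpose.mulVec v₁
    rw [Matrix.dotProduct_mulVec, Matrix.mulVec_transpose, dotProduct_comm]
  simp only [mul_add, sum_add_distrib, ex, ← sum_mul] at e
  exact mul_right_cancel₀ hη.ne' (add_right_cancel e)

/-- The denominators of a Dyson solution are bounded above and below, uniformly in the size of
the matrix and in the spectral parameters. -/
lemma IsDysonSolution.denominator_bounds (h : IsDysonSolution S τ η v₁ v₂) (hn : 1 ≤ n)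
    {sl su τs : ℝ} (hsl : 0 < sl) (hslsu : sl ≤ su) (hτs : 0 < τs) (hτs1 : τs < 1)
    (hS : ∀ i j, sl / n ≤ S i j ∧ S i j ≤ su / n) (hρ : specRad S = 1)
    (hτ : 0 ≤ τ) (hτ1 : τ ≤ 1 - τs) (hη : 0 < η) (hη1 : η ≤ 1) (i : Fin n) :
    (sl / su * √(τs / 2) ≤ η + S.mulVec v₂ i ∧ η + S.mulVec v₂ i ≤ 1 + su / √sl) ∧
      (sl / su * √(τs / 2) ≤ η + S.transpose.mulVec v₁ i ∧
        η + S.transpose.mulVec v₁ i ≤ 1 + su / √sl) := by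
  have hsu := hsl.trans_le hslsu
  have hn0 : (0 : ℝ) < n := by exact_mod_cast hn
  have hS0 : ∀ i j, 0 ≤ S i j := fun i j => le_trans (by positivity) (hS i j).1
  have spec := h.uvec_spec hS0 hη hτ
  set m := (∑ i, v₁ i) / n with hm
  have hm2 : m = (∑ i, v₂ i) / n := by rw [hm, h.sum_eq hS0 hη hτ]
  have hm0 : 0 ≤ m := div_nonneg (sum_nonneg fun i _ => (h.1 i).le) hn0.le
  have lower : ∀ {M x : Fin n → ℝ}, (∀ j, sl / n ≤ M j) → (∀ j, 0 < x j) →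
      sl * ((∑ j, x j) / n) ≤ ∑ j, M j * x j := fun {M x} hM hx => by
    rw [mul_div_left_comm, ← mul_comm (sl / n), mul_sum]
    exact sum_le_sum fun j _ => mul_le_mul_of_nonneg_right (hM j) (hx j).le
  have upper : ∀ {M x : Fin n → ℝ}, (∀ j, M j ≤ su / n) → (∀ j, 0 < x j) →
      ∑ j, M j * x j ≤ su * ((∑ j, x j) / n) := fun {M x} hM hx => by
    rw [mul_div_left_comm, ← mul_comm (su / n), mul_sum]
    exact sum_le_sum fun j _ => mul_le_mul_of_nonneg_right (hM j) (hx j).le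
  have al : ∀ i, η + sl * m ≤ η + S.mulVec v₂ i := fun i => by
    rw [hm2]; exact add_le_add_right (lower (fun j => (hS i j).1) h.2.1) η
  have bl : ∀ i, η + sl * m ≤ η + S.transpose.mulVec v₁ i := fun i =>
    add_le_add_right (lower (fun j => (hS j i).1) h.1) η
  have au : ∀ i, η + S.mulVec v₂ i ≤ η + su * m := fun i => by
    rw [hm2]; exact add_le_add_right (upper (fun j => (hS i j).2) h.2.1) η
  have bu : ∀ i, η + S.transpose.mulVec v₁ i ≤ η + su * m := fun i =>
    add_le_add_right (upper (fun j => (hS j i).2) h.1) η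
  have hupper : η + su * m ≤ 1 + su / √sl := by
    have hv : ∀ i, v₁ i * (sl * m) ≤ 1 := fun i => by
      obtain ⟨ha, hb, hu, e1, -, e⟩ := spec i
      have h1 : v₁ i * (η + S.mulVec v₂ i) ≤ 1 := by
        rw [← e]
        nth_rw 1 [e1]
        nlinarith [mul_nonneg hu.le hτ]
      have h2 : sl * m ≤ η + S.mulVec v₂ i := by linarith [al i]
      exact (mul_le_mul_of_nonneg_left h2 (h.1 i).le).trans h1
    have hmm : m * (sl * m) ≤ 1 := by
      have := sum_le_sum fun i (_ : i ∈ univ) => hv i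
      rw [← sum_mul] at this
      simp only [sum_const, card_univ, Fintype.card_fin, nsmul_eq_mul, mul_one] at this
      nth_rw 1 [hm]
      rwa [div_mul_eq_mul_div, div_le_one hn0]
    have hmle : m ≤ 1 / √sl := by
      rw [le_div_iff₀ (Real.sqrt_pos.2 hsl)]
      refine le_of_sq_le_sq ?_ zero_le_one
      rw [mul_pow, Real.sq_sqrt hsl.le]
      linarith
    have := mul_le_mul_of_nonneg_left hmle hsu.le
    rw [mul_one_div] at this
    linarith
  have hlower : sl / su * √(τs / 2) ≤ η + sl * m := by
    have hbig : √(τs / 2) ≤ η + su * m := by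
      by_contra! hlt
      have hsq : (η + su * m) ^ 2 ≤ τs / 2 := by
        rw [← Real.sq_sqrt (by positivity : 0 ≤ τs / 2)]
        exact pow_le_pow_left₀ (by positivity) hlt.le 2
      have := specRad_le_of_mulVec_le (q := 1 - τs / 2) hS0 (by linarith) h.2.1 fun i => by
        obtain ⟨ha, hb, hu, -, e2, e⟩ := spec i
        have hab : (η + S.mulVec v₂ i) * (η + S.transpose.mulVec v₁ i) + τ ≤ 1 - τs / 2 := by
          have := mul_le_mul (au i) (bu i) hb.le (by positivity)
          nlinarith
        calc S.mulVec v₂ i ≤ η + S.mulVec v₂ i := by linarith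
          _ = ((η + S.mulVec v₂ i) * (η + S.transpose.mulVec v₁ i) + τ) * v₂ i := by
              linear_combination -(η + S.mulVec v₂ i) * e -
                ((η + S.mulVec v₂ i) * (η + S.transpose.mulVec v₁ i) + τ) * e2
          _ ≤ (1 - τs / 2) * v₂ i := mul_le_mul_of_nonneg_right hab (h.2.1 i).le
      linarith
    calc sl / su * √(τs / 2) ≤ sl / su * (η + su * m) := by gcongr
      _ = sl / su * η + sl * m := by field_simp
      _ ≤ η + sl * m := by
          have : sl / su * η ≤ 1 * η := by
            gcongr
            exact (div_le_one hsu).2 hslsu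
          linarith
  exact ⟨⟨hlower.trans (al i), (au i).trans hupper⟩, hlower.trans (bl i), (bu i).trans hupper⟩

end DysonBounds

section AlmostInvariance

variable {n : ℕ} {S : Matrix (Fin n) (Fin n) ℝ} {τ η : ℝ} {v₁ v₂ : Fin n → ℝ}

lemma IsDysonSolution.sqrt_eq (h : IsDysonSolution S τ η v₁ v₂) (hS : ∀ i j, 0 ≤ S i j)
    (hη : 0 < η) (hτ : 0 ≤ τ) (i : Fin n) :
    √(v₁ i * uvec S η v₁ i / v₂ i) =
        √(uvec S η v₁ i * (η + S.transpose.mulVec v₁ i) / (η + S.mulVec v₂ i)) ∧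
      √(v₂ i * uvec S η v₁ i / v₁ i) =
        √(uvec S η v₁ i * (η + S.mulVec v₂ i) / (η + S.transpose.mulVec v₁ i)) ∧
      √(v₂ i / (uvec S η v₁ i * v₁ i)) * v₁ i =
        √(uvec S η v₁ i * (η + S.mulVec v₂ i) * (η + S.transpose.mulVec v₁ i)) ∧
      √(v₁ i / (uvec S η v₁ i * v₂ i)) * v₂ i =
        √(uvec S η v₁ i * (η + S.mulVec v₂ i) * (η + S.transpose.mulVec v₁ i)) := by
  obtain ⟨ha, hb, hu, e1, e2, -⟩ := h.uvec_spec hS hη hτ i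
  have h1 := h.1 i
  have h2 := h.2.1 i
  generalize η + S.mulVec v₂ i = a at *
  generalize η + S.transpose.mulVec v₁ i = b at *
  generalize uvec S η v₁ i = u at *
  generalize v₁ i = x at *
  generalize v₂ i = y at *
  refine ⟨?_, ?_, ?_, ?_⟩
  · congr 1; rw [e1, e2]; field_simp
  · congr 1; rw [e1, e2]; field_simp
  · rw [← Real.sqrt_sq h1.le, ← Real.sqrt_mul (by positivity), Real.sqrt_sq h1.le]
    congr 1; rw [e1, e2]; field_simp
  · rw [← Real.sqrt_sq h2.le, ← Real.sqrt_mul (by positivity), Real.sqrt_sq h2.le]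
    congr 1; rw [e1, e2]; field_simp

lemma FM_mulVec_inl (f : Fin n ⊕ Fin n → ℝ) (i : Fin n) :
    (FM S η v₁ v₂).mulVec f (.inl i) =
      ∑ j, √(v₁ i * uvec S η v₁ i / v₂ i) * S i j * √(v₂ j * uvec S η v₁ j / v₁ j) *
        f (.inr j) := by
  simp [FM, SoM, Matrix.mulVec, dotProduct, Matrix.diagonal_mul, Matrix.mul_diagonal]

lemma FM_mulVec_inr (f : Fin n ⊕ Fin n → ℝ) (i : Fin n) :
    (FM S η v₁ v₂).mulVec f (.inr i) =
      ∑ j, √(v₂ i * uvec S η v₁ i / v₁ i) * S j i * √(v₁ j * uvec S η v₁ j / v₂ j) *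
        f (.inl j) := by
  simp [FM, SoM, Matrix.mulVec, dotProduct, Matrix.diagonal_mul, Matrix.mul_diagonal]

/-- `F (V v) = V v - η w` with `w = √(v u / ṽ)`. -/
lemma IsDysonSolution.FM_mulVec_Vv (h : IsDysonSolution S τ η v₁ v₂) (hS : ∀ i j, 0 ≤ S i j)
    (hη : 0 < η) (hτ : 0 ≤ τ) (i : Fin n) :
    (∑ j, √(v₁ i * uvec S η v₁ i / v₂ i) * S i j * √(v₂ j * uvec S η v₁ j / v₁ j) *
        Vv S η v₁ v₂ (.inr j) =
      Vv S η v₁ v₂ (.inl i) - η * √(v₁ i * uvec S η v₁ i / v₂ i)) ∧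
    ∑ j, √(v₂ i * uvec S η v₁ i / v₁ i) * S j i * √(v₁ j * uvec S η v₁ j / v₂ j) *
        Vv S η v₁ v₂ (.inl j) =
      Vv S η v₁ v₂ (.inr i) - η * √(v₂ i * uvec S η v₁ i / v₁ i) := by
  have key1 : ∀ j, √(v₂ j * uvec S η v₁ j / v₁ j) * Vv S η v₁ v₂ (.inr j) = v₂ j := fun j => by
    obtain ⟨-, -, hu, -⟩ := h.uvec_spec hS hη hτ j
    have h1 := h.1 j
    have h2 := h.2.1 j
    simp only [Vv, Sum.elim_inr]
    rw [← mul_assoc, ← Real.sqrt_mul (by positivity)]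
    have : v₂ j * uvec S η v₁ j / v₁ j * (v₁ j / (uvec S η v₁ j * v₂ j)) = 1 := by field_simp
    rw [this, Real.sqrt_one, one_mul]
  have key2 : ∀ j, √(v₁ j * uvec S η v₁ j / v₂ j) * Vv S η v₁ v₂ (.inl j) = v₁ j := fun j => by
    obtain ⟨-, -, hu, -⟩ := h.uvec_spec hS hη hτ j
    have h1 := h.1 j
    have h2 := h.2.1 j
    simp only [Vv, Sum.elim_inl]
    rw [← mul_assoc, ← Real.sqrt_mul (by positivity)]
    have : v₁ j * uvec S η v₁ j / v₂ j * (v₂ j / (uvec S η v₁ j * v₁ j)) = 1 := by field_simp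
    rw [this, Real.sqrt_one, one_mul]
  obtain ⟨ha, hb, hu, e1, e2, -⟩ := h.uvec_spec hS hη hτ i
  obtain ⟨s1, s2, s3, s4⟩ := h.sqrt_eq hS hη hτ i
  constructor
  · have hsum : ∑ j, √(v₁ i * uvec S η v₁ i / v₂ i) * S i j *
        √(v₂ j * uvec S η v₁ j / v₁ j) * Vv S η v₁ v₂ (.inr j) =
        √(v₁ i * uvec S η v₁ i / v₂ i) * S.mulVec v₂ i := by
      rw [Matrix.mulVec, dotProduct, mul_sum]
      exact sum_congr rfl fun j _ => by rw [mul_assoc (_ * _), key1, mul_assoc]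
    have hV : Vv S η v₁ v₂ (.inl i) =
        √(v₁ i * uvec S η v₁ i / v₂ i) * (η + S.mulVec v₂ i) := by
      simp only [Vv, Sum.elim_inl]
      rw [s3, s1, ← Real.sqrt_sq ha.le, ← Real.sqrt_mul (by positivity), Real.sqrt_sq ha.le]
      congr 1
      field_simp
    rw [hsum, hV]
    ring
  · have hsum : ∑ j, √(v₂ i * uvec S η v₁ i / v₁ i) * S j i *
        √(v₁ j * uvec S η v₁ j / v₂ j) * Vv S η v₁ v₂ (.inl j) =
        √(v₂ i * uvec S η v₁ i / v₁ i) * S.transpose.mulVec v₁ i := by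
      rw [Matrix.mulVec, dotProduct, mul_sum]
      exact sum_congr rfl fun j _ => by
        rw [mul_assoc (_ * _), key2, mul_assoc, Matrix.transpose_apply]
    have hV : Vv S η v₁ v₂ (.inr i) =
        √(v₂ i * uvec S η v₁ i / v₁ i) * (η + S.transpose.mulVec v₁ i) := by
      simp only [Vv, Sum.elim_inr]
      rw [s4, s2, ← Real.sqrt_sq hb.le, ← Real.sqrt_mul (by positivity), Real.sqrt_sq hb.le]
      congr 1
      field_simp
    rw [hsum, hV]
    ring

end AlmostInvariance

end Auxiliary

/-- **Approximation of the unstable eigenvector:** with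
`a := e₋ (V v)/‖V v‖₂`, the eigenvector `f₋ = e₋ f₊` of `F` satisfies
`max_k |(f₋)_k − a_k| ≤ C η` uniformly for `η ∈ (0,1]` and `τ ∈ [0, 1−τ⁎]`,
with `C` depending only on `s⁎, s⁺, τ⁎`. -/
theorem approximation_of_unstable_eigenvector
    (sl su τs : ℝ) (hsl : 0 < sl) (hslsu : sl ≤ su)
    (hτs : 0 < τs) (hτs1 : τs < 1) :
    ∃ C > (0:ℝ),
      ∀ (n : ℕ), 1 ≤ n → ∀ S : Matrix (Fin n) (Fin n) ℝ,
        (∀ i j, sl / n ≤ S i j ∧ S i j ≤ su / n) → specRad S = 1 →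
        ∀ τ : ℝ, 0 ≤ τ → τ ≤ 1 - τs → ∀ η : ℝ, 0 < η → η ≤ 1 →
        ∀ v₁ v₂ : Fin n → ℝ, IsDysonSolution S τ η v₁ v₂ →
        ∀ fp : Fin n ⊕ Fin n → ℝ,
          ((∀ k, 0 < fp k) ∧ nrm2 fp = 1 ∧
            (FM S η v₁ v₂).mulVec fp = opNorm2 (FM S η v₁ v₂) • fp) →
          ∀ k, |eMinus k * fp k -
              eMinus k * Vv S η v₁ v₂ k / nrm2 (Vv S η v₁ v₂)| ≤ C * η := by
  set α := sl / su * √(τs / 2)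
  set β := 1 + su / √sl
  have hsu := hsl.trans_le hslsu
  have hα : 0 < α := by positivity
  have hβ : 0 < β := by positivity
  set p := √(1 / (β ^ 2 + 1) * α / β)
  set q := √(1 / α ^ 2 * β / α)
  have hp : 0 < p := by positivity
  have hq : 0 < q := by positivity
  set κ := √(1 / (β ^ 2 + 1) * α * α)
  set K := √(1 / α ^ 2 * β * β)
  have hκ : 0 < κ := by positivity
  obtain ⟨C, hC, H⟩ := bipartite_eigenvector_approximation
    (c := p * sl * p) (d := max (p * sl * p) (q * su * q)) (κ := κ) (K := max K q)
    (by positivity) (le_max_left _ _) hκ (lt_max_of_lt_right hq)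
  refine ⟨C, hC, ?_⟩
  rintro n hn S hS hρ τ hτ hτ1 η hη hη1 v₁ v₂ h fp ⟨hfp, hfp1, hfe⟩ k
  have hn0 : (0 : ℝ) < n := by exact_mod_cast hn
  have hS0 : ∀ i j, 0 ≤ S i j := fun i j => le_trans (by positivity) (hS i j).1
  have hab := h.denominator_bounds hn hsl hslsu hτs hτs1 hS hρ hτ hτ1 hη hη1
  have hu : ∀ i, 1 / (β ^ 2 + 1) ≤ uvec S η v₁ i ∧ uvec S η v₁ i ≤ 1 / α ^ 2 := fun i => by
    obtain ⟨ha, hb, hu, -, -, e⟩ := h.uvec_spec hS0 hη hτ i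
    obtain ⟨⟨al, au⟩, bl, bu⟩ := hab i
    constructor
    · rw [div_le_iff₀ (by positivity), ← e]
      refine mul_le_mul_of_nonneg_left ?_ hu.le
      have := mul_le_mul au bu hb.le hβ.le
      nlinarith
    · rw [le_div_iff₀ (by positivity), ← e]
      refine mul_le_mul_of_nonneg_left ?_ hu.le
      have := mul_le_mul al bl hα.le ha.le
      nlinarith
  have hw₁ : ∀ i, p ≤ √(v₁ i * uvec S η v₁ i / v₂ i) ∧
      √(v₁ i * uvec S η v₁ i / v₂ i) ≤ q := fun i => by
    obtain ⟨ha, hb, hu0, -⟩ := h.uvec_spec hS0 hη hτ i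
    obtain ⟨⟨al, au⟩, bl, bu⟩ := hab i
    obtain ⟨ul, uu⟩ := hu i
    rw [(h.sqrt_eq hS0 hη hτ i).1]
    exact ⟨Real.sqrt_le_sqrt (by gcongr), Real.sqrt_le_sqrt (by gcongr)⟩
  have hw₂ : ∀ i, p ≤ √(v₂ i * uvec S η v₁ i / v₁ i) ∧
      √(v₂ i * uvec S η v₁ i / v₁ i) ≤ q := fun i => by
    obtain ⟨ha, hb, hu0, -⟩ := h.uvec_spec hS0 hη hτ i
    obtain ⟨⟨al, au⟩, bl, bu⟩ := hab i
    obtain ⟨ul, uu⟩ := hu i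
    rw [(h.sqrt_eq hS0 hη hτ i).2.1]
    exact ⟨Real.sqrt_le_sqrt (by gcongr), Real.sqrt_le_sqrt (by gcongr)⟩
  have hV : ∀ k, κ ≤ Vv S η v₁ v₂ k ∧ Vv S η v₁ v₂ k ≤ max K q := fun k => by
    have hg : ∀ i, κ ≤ √(uvec S η v₁ i * (η + S.mulVec v₂ i) * (η + S.transpose.mulVec v₁ i)) ∧
        √(uvec S η v₁ i * (η + S.mulVec v₂ i) * (η + S.transpose.mulVec v₁ i)) ≤ K := fun i => by
      obtain ⟨ha, hb, hu0, -⟩ := h.uvec_spec hS0 hη hτ i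
      obtain ⟨⟨al, au⟩, bl, bu⟩ := hab i
      obtain ⟨ul, uu⟩ := hu i
      exact ⟨Real.sqrt_le_sqrt (by gcongr), Real.sqrt_le_sqrt (by gcongr)⟩
    rcases k with i | i
    · simp only [Vv, Sum.elim_inl]
      rw [(h.sqrt_eq hS0 hη hτ i).2.2.1]
      exact ⟨(hg i).1, (hg i).2.trans (le_max_left _ _)⟩
    · simp only [Vv, Sum.elim_inr]
      rw [(h.sqrt_eq hS0 hη hτ i).2.2.2]
      exact ⟨(hg i).1, (hg i).2.trans (le_max_left _ _)⟩
  have entry : ∀ {x s y : ℝ}, p ≤ x ∧ x ≤ q → sl / n ≤ s ∧ s ≤ su / n → p ≤ y ∧ y ≤ q →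
      p * sl * p / n ≤ x * s * y ∧ x * s * y ≤ max (p * sl * p) (q * su * q) / n := by
    intro x s y hx hs hy
    have hx0 := hp.trans_le hx.1
    have hy0 := hp.trans_le hy.1
    have hs0 : 0 ≤ s := le_trans (by positivity) hs.1
    constructor
    · calc p * sl * p / n = p * (sl / n) * p := by ring
        _ ≤ x * s * y := by
          gcongr
          exacts [hx.1, hs.1, hy.1]
    · calc x * s * y ≤ q * (su / n) * q := by
            gcongr
            exacts [hx.2, hs.2, hy.2]
        _ = q * su * q / n := by ring
        _ ≤ _ := by
          gcongr
          exact le_max_right _ _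
  have main := H n hn
    (fun i j => √(v₁ i * uvec S η v₁ i / v₂ i) * S i j * √(v₂ j * uvec S η v₁ j / v₁ j))
    (fun i j => √(v₂ i * uvec S η v₁ i / v₁ i) * S j i * √(v₁ j * uvec S η v₁ j / v₂ j))
    (fun i j => entry (hw₁ i) (hS i j) (hw₂ j)) (fun i j => entry (hw₂ i) (hS j i) (hw₁ j))
    (opNorm2 (FM S η v₁ v₂)) η hη fp (Vv S η v₁ v₂)
    (Sum.elim (fun i => √(v₁ i * uvec S η v₁ i / v₂ i))
      (fun i => √(v₂ i * uvec S η v₁ i / v₁ i)))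
    hfp hfp1 hV
    (Sum.rec (fun i => ⟨Real.sqrt_nonneg _, (hw₁ i).2.trans (le_max_right _ _)⟩)
      (fun i => ⟨Real.sqrt_nonneg _, (hw₂ i).2.trans (le_max_right _ _)⟩))
    (fun i => by rw [← FM_mulVec_inl, hfe]; rfl)
    (fun i => by rw [← FM_mulVec_inr, hfe]; rfl)
    (fun i => (h.FM_mulVec_Vv hS0 hη hτ i).1)
    (fun i => (h.FM_mulVec_Vv hS0 hη hτ i).2) k
  have hsign : |(eMinus k : ℝ)| = 1 := by
    rcases k with i | i <;> simp [eMinus]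
  rwa [mul_div_assoc, ← mul_sub, abs_mul, hsign, one_mul]
end
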